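/- arXiv:2309.05190 — 2 statements merged into one kernel-verified Lean document; each statement's English description precedes it below -/
import Mathlib

section
/- For every integer k ≥ 1, real λ > 0, and every integer n ≥ 1, writing p_m = f_k(m;λ) with the convention p_m = 0 for m < 0 and p_0 = e^{−kλ}, the pmf satisfies the four-term recurrence n·p_n = (2n + λ − 2)·p_{n−1} − (n − 2)·p_{n−2} − (k+1)λ·p_{n−k−1} + kλ·p_{n−k−2}. -/
open scoped BigOperators

/-- The pmf of the Poisson distribution of order `k` with parameter `lam`:
`f_k(n;λ) = e^{-kλ} Σ_{n₁+2n₂+⋯+k n_k = n} λ^{n₁+⋯+n_k}/(n₁!⋯n_k!)`. -/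
noncomputable def poissonOrderKPmf (k : ℕ) (lam : ℝ) (n : ℕ) : ℝ :=
  Real.exp (-(k * lam)) *
    ∑' v : Fin k → ℕ,
      if (∑ i : Fin k, ((i : ℕ) + 1) * v i) = n then
        lam ^ (∑ i : Fin k, v i) / ((∏ i : Fin k, Nat.factorial (v i) : ℕ) : ℝ)
      else 0

/-- The median of the Poisson distribution of order `k` with parameter `lam`:
the least integer `n` such that `P(X ≤ n) ≥ 1/2`. -/
noncomputable def poissonOrderKMedian (k : ℕ) (lam : ℝ) : ℕ :=
  sInf {n : ℕ | (1 : ℝ) / 2 ≤ ∑ j ∈ Finset.range (n + 1), poissonOrderKPmf k lam j}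

/-- The weight `λ^{n₁+⋯+n_k}/(n₁!⋯n_k!)` of a tuple. -/
noncomputable def tupleWeight {k : ℕ} (lam : ℝ) (v : Fin k → ℕ) : ℝ :=
  lam ^ (∑ i, v i) / ((∏ i, Nat.factorial (v i) : ℕ) : ℝ)

/-- The sum of the weights of the tuples with `n₁+2n₂+⋯+k n_k = m`, for an integer `m`. -/
noncomputable def weightSum (k : ℕ) (lam : ℝ) (m : ℤ) : ℝ :=
  ∑' v : Fin k → ℕ,
    if ((∑ i : Fin k, ((i : ℕ) + 1) * v i : ℕ) : ℤ) = m then tupleWeight lam v else 0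

lemma finite_setOf_tuple_sum_eq (k : ℕ) (m : ℤ) :
    {v : Fin k → ℕ | ((∑ i : Fin k, ((i : ℕ) + 1) * v i : ℕ) : ℤ) = m}.Finite := by
  refine (Set.finite_Iic (fun _ : Fin k => m.toNat)).subset fun v hv i => ?_
  have h := Finset.single_le_sum (f := fun i : Fin k => ((i : ℕ) + 1) * v i)
    (fun _ _ => Nat.zero_le _) (Finset.mem_univ i)
  change v i ≤ m.toNat
  have h' : v i ≤ ((i : ℕ) + 1) * v i := Nat.le_mul_of_pos_left _ (Nat.succ_pos _)
  have hv' : ((∑ i : Fin k, ((i : ℕ) + 1) * v i : ℕ) : ℤ) = m := hv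
  omega

lemma summable_tuple_ite {k : ℕ} (m : ℤ) (F : (Fin k → ℕ) → ℝ) :
    Summable fun v : Fin k → ℕ =>
      if ((∑ i : Fin k, ((i : ℕ) + 1) * v i : ℕ) : ℤ) = m then F v else 0 := by
  refine summable_of_hasFiniteSupport ((finite_setOf_tuple_sum_eq k m).subset fun v hv => ?_)
  by_contra h
  exact hv (if_neg h)

lemma tupleWeight_add_single {k : ℕ} (lam : ℝ) (j : Fin k) (v : Fin k → ℕ) :
    ((v j : ℝ) + 1) * tupleWeight lam (v + Pi.single j 1 : Fin k → ℕ) = lam * tupleWeight lam v := by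
  have hsum : ∑ i, (v + Pi.single j 1 : Fin k → ℕ) i = ∑ i, v i + 1 := by
    simp [Finset.sum_add_distrib]
  have hprod : ∏ i, Nat.factorial ((v + Pi.single j 1 : Fin k → ℕ) i)
      = (v j + 1) * ∏ i, Nat.factorial (v i) := by
    rw [← Finset.mul_prod_erase _ _ (Finset.mem_univ j),
      ← Finset.mul_prod_erase Finset.univ (fun i => Nat.factorial (v i)) (Finset.mem_univ j),
      ← mul_assoc]
    congr 1
    · simp [Nat.factorial_succ]
    · refine Finset.prod_congr rfl fun i hi => ?_
      simp [Finset.ne_of_mem_erase hi]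
  have hpos : ((∏ i, Nat.factorial (v i) : ℕ) : ℝ) ≠ 0 :=
    Nat.cast_ne_zero.mpr (Finset.prod_ne_zero_iff.mpr fun i _ => Nat.factorial_ne_zero _)
  have hj : (v j : ℝ) + 1 ≠ 0 := by positivity
  rw [tupleWeight, tupleWeight, hsum, hprod, pow_succ, Nat.cast_mul, Nat.cast_add_one]
  field_simp

lemma tsum_apply_mul_tupleWeight {k : ℕ} (lam : ℝ) (j : Fin k) (m : ℤ) :
    ∑' v : Fin k → ℕ, (if ((∑ i : Fin k, ((i : ℕ) + 1) * v i : ℕ) : ℤ) = m then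
      (v j : ℝ) * tupleWeight lam v else 0) = lam * weightSum k lam (m - (j : ℕ) - 1) := by
  rw [weightSum, ← tsum_mul_left,
    ← (add_left_injective (Pi.single j 1 : Fin k → ℕ)).tsum_eq]
  · refine tsum_congr fun v => ?_
    have hsum : ∑ i : Fin k, ((i : ℕ) + 1) * (v + Pi.single j 1 : Fin k → ℕ) i
        = ∑ i : Fin k, ((i : ℕ) + 1) * v i + ((j : ℕ) + 1) := by
      simp [mul_add, Finset.sum_add_distrib, Pi.single_apply]
    rw [hsum, mul_ite, mul_zero, ← tupleWeight_add_single lam j v]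
    refine if_congr ?_ ?_ rfl
    · omega
    · simp
  · intro v hv
    have hj : v j ≠ 0 := by
      rintro h
      simp [h] at hv
    refine ⟨v - Pi.single j 1, ?_⟩
    funext i
    by_cases h : i = j
    · subst h
      simp
      omega
    · simp [h]

lemma mul_weightSum (k : ℕ) (lam : ℝ) (m : ℤ) :
    (m : ℝ) * weightSum k lam m =
      lam * ∑ j ∈ Finset.range k, ((j : ℝ) + 1) * weightSum k lam (m - j - 1) := by
  rw [← Fin.sum_univ_eq_sum_range fun j : ℕ => ((j : ℝ) + 1) * weightSum k lam (m - j - 1),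
    Finset.mul_sum]
  calc (m : ℝ) * weightSum k lam m
      = ∑' v : Fin k → ℕ, ∑ j : Fin k, ((j : ℕ) + 1 : ℝ) *
          (if ((∑ i : Fin k, ((i : ℕ) + 1) * v i : ℕ) : ℤ) = m then
            (v j : ℝ) * tupleWeight lam v else 0) := by
        rw [weightSum, ← tsum_mul_left]
        refine tsum_congr fun v => ?_
        split_ifs with h
        · have h' : (m : ℝ) = ∑ i : Fin k, ((i : ℕ) + 1 : ℝ) * v i := by
            rw [← h]
            push_cast
            rfl
          rw [h', Finset.sum_mul]
          exact Finset.sum_congr rfl fun i _ => mul_assoc _ _ _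
        · simp
    _ = ∑ j : Fin k, lam * (((j : ℕ) + 1 : ℝ) * weightSum k lam (m - (j : ℕ) - 1)) := by
        rw [Summable.tsum_finsetSum fun j _ => (summable_tuple_ite m _).mul_left _]
        refine Finset.sum_congr rfl fun j _ => ?_
        rw [tsum_mul_left, tsum_apply_mul_tupleWeight]
        ring

lemma sum_mul_second_difference (P : ℤ → ℝ) (m : ℤ) (k : ℕ) :
    ∑ j ∈ Finset.range k, ((j : ℝ) + 1) * P (m - j - 1)
      - 2 * ∑ j ∈ Finset.range k, ((j : ℝ) + 1) * P (m - 1 - j - 1)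
      + ∑ j ∈ Finset.range k, ((j : ℝ) + 1) * P (m - 2 - j - 1)
      = P (m - 1) - ((k : ℝ) + 1) * P (m - k - 1) + k * P (m - k - 2) := by
  induction k with
  | zero => simp
  | succ k ih =>
    simp only [Finset.sum_range_succ]
    rw [show m - 1 - (k : ℤ) - 1 = m - k - 2 by ring,
      show m - 2 - (k : ℤ) - 1 = m - k - 3 by ring,
      show m - ((k + 1 : ℕ) : ℤ) - 1 = m - k - 2 by push_cast; ring,
      show m - ((k + 1 : ℕ) : ℤ) - 2 = m - k - 3 by push_cast; ring]
    push_cast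
    linear_combination ih

lemma weightSum_of_neg (k : ℕ) (lam : ℝ) {m : ℤ} (hm : m < 0) : weightSum k lam m = 0 := by
  refine (tsum_congr fun v => if_neg ?_).trans tsum_zero
  omega

lemma weightSum_zero (k : ℕ) (lam : ℝ) : weightSum k lam 0 = 1 := by
  rw [weightSum, tsum_eq_single 0]
  · simp [tupleWeight]
  · intro v hv
    refine if_neg fun h => hv ?_
    funext i
    rw [Nat.cast_eq_zero, Finset.sum_eq_zero_iff] at h
    simpa using h i (Finset.mem_univ i)

lemma poissonOrderKPmf_eq_weightSum (k : ℕ) (lam : ℝ) (n : ℕ) :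
    poissonOrderKPmf k lam n = Real.exp (-(k * lam)) * weightSum k lam n := by
  simp only [poissonOrderKPmf, weightSum, tupleWeight, Nat.cast_inj]

/-- (Kostadinova–Minkova four-term recurrence.) For every integer k ≥ 1,
real λ > 0 and integer n ≥ 1, writing p_m = f_k(m;λ) with p_m = 0 for m < 0 and
p_0 = e^{−kλ}, one has
n·p_n = (2n + λ − 2)·p_{n−1} − (n − 2)·p_{n−2} − (k+1)λ·p_{n−k−1} + kλ·p_{n−k−2}. -/
theorem poissonOrderK_four_term_recurrence (k : ℕ) (hk : 1 ≤ k) (lam : ℝ) (hlam : 0 < lam)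
    (p : ℤ → ℝ)
    (hp : ∀ m : ℤ, p m = if 0 ≤ m then poissonOrderKPmf k lam m.toNat else 0) :
    p 0 = Real.exp (-(k * lam)) ∧
    ∀ n : ℕ, 1 ≤ n →
      (n : ℝ) * p n =
        (2 * (n : ℝ) + lam - 2) * p ((n : ℤ) - 1)
          - ((n : ℝ) - 2) * p ((n : ℤ) - 2)
          - ((k : ℝ) + 1) * lam * p ((n : ℤ) - (k : ℤ) - 1)
          + (k : ℝ) * lam * p ((n : ℤ) - (k : ℤ) - 2) := by
  have hP : ∀ m : ℤ, p m = Real.exp (-(k * lam)) * weightSum k lam m := by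
    intro m
    rw [hp]
    split_ifs with h
    · rw [poissonOrderKPmf_eq_weightSum, Int.toNat_of_nonneg h]
    · rw [weightSum_of_neg k lam (not_le.mp h), mul_zero]
  refine ⟨by rw [hP, weightSum_zero, mul_one], fun n _ => ?_⟩
  have h0 := mul_weightSum k lam n
  have h1 := mul_weightSum k lam (n - 1)
  have h2 := mul_weightSum k lam (n - 2)
  have h3 := sum_mul_second_difference (weightSum k lam) n k
  push_cast at h0 h1 h2
  simp only [hP]
  linear_combination Real.exp (-(k * lam)) * (h0 - 2 * h1 + h2 + lam * h3)
end

section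
/- (Conjecture.) Fix an integer k ≥ 1 and let n be a positive integer with n ≥ κ; set λ = n/κ (so the mean equals n). Then the median of the Poisson distribution of order k with parameter λ is ν_k(n/κ) = n − ⌊(k+4)/8⌋. In particular, for n ≥ κ a unit increase in n yields a unit increase in the median. -/
open scoped BigOperators

/-- The pmf without its normalising factor `exp (-kλ)`. -/
noncomputable def poissonOrderKWeight (k : ℕ) (lam : ℝ) (n : ℕ) : ℝ :=
  ∑' v : Fin k → ℕ,
    if (∑ i : Fin k, ((i : ℕ) + 1) * v i) = n then
      lam ^ (∑ i : Fin k, v i) / ((∏ i : Fin k, Nat.factorial (v i) : ℕ) : ℝ)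
    else 0

theorem summable_norm_and_hasSum_pi_prod {𝕜 : Type*} [NormedField 𝕜] [CompleteSpace 𝕜] :
    ∀ (k : ℕ) (f : Fin k → ℕ → 𝕜), (∀ i, Summable fun a => ‖f i a‖) →
      (Summable fun v : Fin k → ℕ => ‖∏ i : Fin k, f i (v i)‖) ∧
        HasSum (fun v : Fin k → ℕ => ∏ i : Fin k, f i (v i)) (∏ i : Fin k, ∑' a, f i a)
  | 0, f, _ => by
    simp only [Finset.univ_eq_empty, Finset.prod_empty, norm_one]
    exact ⟨(hasSum_fintype _).summable, by simp⟩
  | k + 1, f, hf => by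
    obtain ⟨h1, h2⟩ := summable_norm_and_hasSum_pi_prod k (fun i => f i.succ) fun i => hf _
    have h0 := hf 0
    let E : ℕ × (Fin k → ℕ) ≃ (Fin (k + 1) → ℕ) := Fin.consEquiv fun _ : Fin (k + 1) => ℕ
    have hcons : ∀ p : ℕ × (Fin k → ℕ),
        ∏ i : Fin (k + 1), f i (E p i) = f 0 p.1 * ∏ i : Fin k, f i.succ (p.2 i) := fun p => by
      rw [Fin.prod_univ_succ]
      rfl
    clear_value E
    constructor
    · refine E.summable_iff.1 (Summable.congr (Summable.mul_of_nonneg h0 h1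
        (fun _ => norm_nonneg _) fun _ => norm_nonneg _) fun p => ?_)
      rw [Function.comp_apply, hcons, norm_mul]
    · rw [Fin.prod_univ_succ]
      have h3 : Summable fun p : ℕ × (Fin k → ℕ) => f 0 p.1 * ∏ i : Fin k, f i.succ (p.2 i) :=
        summable_mul_of_summable_norm (f := f 0)
          (g := fun v : Fin k → ℕ => ∏ i : Fin k, f i.succ (v i)) h0 h1
      have h4 := HasSum.mul (f := f 0) h0.of_norm.hasSum h2 h3
      refine E.hasSum_iff.1 (h4.congr_fun fun p => ?_)
      rw [Function.comp_apply, hcons]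

theorem hasSum_poissonOrderKWeight (k : ℕ) (lam : ℝ) (z : ℂ) :
    HasSum (fun n : ℕ => (poissonOrderKWeight k lam n : ℂ) * z ^ n)
      (Complex.exp (lam * ∑ i : Fin k, z ^ ((i : ℕ) + 1))) := by
  obtain ⟨h1, h2⟩ := summable_norm_and_hasSum_pi_prod k
    (fun i a => ((lam : ℂ) * z ^ ((i : ℕ) + 1)) ^ a / (a.factorial : ℂ))
    fun i => NormedSpace.norm_expSeries_div_summable (𝔸 := ℂ) _
  have h3 : ∀ i : Fin k, ∑' a : ℕ, (lam * z ^ ((i : ℕ) + 1)) ^ a / (a.factorial : ℂ) =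
      Complex.exp (lam * z ^ ((i : ℕ) + 1)) := fun i => by
    rw [Complex.exp_eq_exp_ℂ, NormedSpace.exp_eq_tsum_div]
  simp only [h3, ← Complex.exp_sum, ← Finset.mul_sum] at h2
  rw [← (Equiv.sigmaFiberEquiv fun v : Fin k → ℕ =>
    ∑ i : Fin k, ((i : ℕ) + 1) * v i).hasSum_iff] at h2
  refine h2.sigma fun n => ?_
  have h4 : Summable fun v : Fin k → ℕ =>
      ∏ i : Fin k, ((lam : ℂ) * z ^ ((i : ℕ) + 1)) ^ v i / ((v i).factorial : ℂ) := h1.of_norm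
  have h5 := (h4.subtype {v | ∑ i : Fin k, ((i : ℕ) + 1) * v i = n}).hasSum
  have h6 : (poissonOrderKWeight k lam n : ℂ) * z ^ n =
      ∑' v : {v : Fin k → ℕ | ∑ i : Fin k, ((i : ℕ) + 1) * v i = n},
        ∏ i : Fin k, ((lam : ℂ) * z ^ ((i : ℕ) + 1)) ^ (v : Fin k → ℕ) i /
          (((v : Fin k → ℕ) i).factorial : ℂ) := by
    unfold poissonOrderKWeight
    rw [Complex.ofReal_tsum, ← tsum_mul_right,
      tsum_subtype {v : Fin k → ℕ | ∑ i : Fin k, ((i : ℕ) + 1) * v i = n}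
      (fun v : Fin k → ℕ => ∏ i : Fin k, ((lam : ℂ) * z ^ ((i : ℕ) + 1)) ^ v i /
        ((v i).factorial : ℂ))]
    refine tsum_congr fun v => ?_
    by_cases hv : ∑ i : Fin k, ((i : ℕ) + 1) * v i = n
    · rw [Set.indicator_of_mem (by exact hv), if_pos hv, Finset.prod_div_distrib]
      simp only [mul_pow, Finset.prod_mul_distrib, Finset.prod_pow_eq_pow_sum, ← pow_mul, hv]
      push_cast
      ring
    · rw [Set.indicator_of_notMem (by exact hv), if_neg hv]
      simp
  rw [h6]
  exact h5

theorem poissonOrderKWeight_nonneg (k : ℕ) {lam : ℝ} (h : 0 ≤ lam) (n : ℕ) :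
    0 ≤ poissonOrderKWeight k lam n :=
  tsum_nonneg fun v => by split_ifs <;> positivity

theorem poissonOrderKPmf_eq (k : ℕ) (lam : ℝ) (n : ℕ) :
    poissonOrderKPmf k lam n = Real.exp (-(k * lam)) * poissonOrderKWeight k lam n := rfl

theorem poissonOrderKWeight_zero (k : ℕ) (lam : ℝ) : poissonOrderKWeight k lam 0 = 1 := by
  rw [poissonOrderKWeight, tsum_eq_single 0]
  · simp
  · intro v hv
    rw [if_neg]
    intro h
    apply hv
    ext i
    have := (Finset.sum_eq_zero_iff.1 h) i (Finset.mem_univ i)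
    simpa using this

/-- Panjer's recursion for the weights. -/
theorem poissonOrderKWeight_rec (k : ℕ) (lam : ℝ) (n : ℕ) :
    n * poissonOrderKWeight k lam n =
      lam * ∑ i : Fin k, if (i : ℕ) + 1 ≤ n then
        ((i : ℕ) + 1) * poissonOrderKWeight k lam (n - ((i : ℕ) + 1)) else 0 := by
  have hfin : ∀ m : ℕ, {v : Fin k → ℕ | ∑ i : Fin k, ((i : ℕ) + 1) * v i = m}.Finite := fun m => by
    refine (Set.Finite.pi' fun _ : Fin k => Set.finite_Iic m).subset fun v hv i => ?_
    have := Finset.single_le_sum (f := fun i : Fin k => ((i : ℕ) + 1) * v i) (fun _ _ => Nat.zero_le _)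
      (Finset.mem_univ i)
    simp only [Set.mem_ofPred_eq] at hv
    simp only [Set.mem_Iic]
    nlinarith
  set w : (Fin k → ℕ) → ℝ := fun v =>
    lam ^ (∑ i : Fin k, v i) / ((∏ i : Fin k, Nat.factorial (v i) : ℕ) : ℝ) with hw
  set s : (Fin k → ℕ) → ℕ := fun v => ∑ i : Fin k, ((i : ℕ) + 1) * v i with hs
  have hW : ∀ m, poissonOrderKWeight k lam m = ∑' v, if s v = m then w v else 0 := fun m => rfl
  have hsum : ∀ (m : ℕ) (g : (Fin k → ℕ) → ℝ), Summable fun v => if s v = m then g v else 0 :=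
    fun m g => summable_of_hasFiniteSupport ((hfin m).subset fun v hv => by
      by_contra hc
      exact hv (if_neg hc))
  have hstep : ∀ i : Fin k, (∑' v, if s v = n then (v i : ℝ) * w v else 0) =
      if (i : ℕ) + 1 ≤ n then lam * poissonOrderKWeight k lam (n - ((i : ℕ) + 1)) else 0 := by
    intro i
    have hinj : Function.Injective fun v : Fin k → ℕ => v + Pi.single i 1 :=
      fun a b h => by simpa using h
    have hsadd : ∀ v : Fin k → ℕ, s (v + Pi.single i 1) = s v + (i + 1) := fun v => by
      simp [hs, mul_add, Finset.sum_add_distrib, Pi.single_apply]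
    rw [← hinj.tsum_eq]
    · have hwadd : ∀ v : Fin k → ℕ,
          (((v + Pi.single i 1 : Fin k → ℕ) i : ℕ) : ℝ) * w (v + Pi.single i 1) = lam * w v := by
        intro v
        have h1 : ∑ j, (v + Pi.single i 1 : Fin k → ℕ) j = ∑ j, v j + 1 := by
          simp [Finset.sum_add_distrib, Pi.single_apply]
        have h2 : ∏ j, ((v + Pi.single i 1 : Fin k → ℕ) j).factorial =
            (v i + 1) * ∏ j, (v j).factorial := by
          rw [← Finset.mul_prod_erase _ _ (Finset.mem_univ i),
            ← Finset.mul_prod_erase _ (fun j => (v j).factorial) (Finset.mem_univ i), ← mul_assoc]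
          congr 1
          · simp [Nat.factorial_succ]
          · refine Finset.prod_congr rfl fun j hj => ?_
            simp [Pi.single_eq_of_ne (Finset.ne_of_mem_erase hj)]
        simp only [hw, h1, h2]
        have : ((∏ j, (v j).factorial : ℕ) : ℝ) ≠ 0 := by
          exact_mod_cast (Finset.prod_ne_zero_iff.2 fun j _ => Nat.factorial_ne_zero _)
        have h3 : (v i : ℝ) + 1 ≠ 0 := by positivity
        rw [Nat.cast_mul]
        simp only [Pi.add_apply, Pi.single_eq_same]
        push_cast at this ⊢
        field_simp
        ring
      simp only [hwadd, hsadd]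
      split_ifs with hle
      · rw [hW, ← tsum_mul_left]
        refine tsum_congr fun v => ?_
        have : s v + (i + 1) = n ↔ s v = n - (i + 1) := by omega
        simp only [this]
        split_ifs <;> simp
      · exact (tsum_congr fun v => if_neg (by omega)).trans tsum_zero
    · intro v hv
      have hvi : v i ≠ 0 := by
        intro h
        apply hv
        simp [h]
      refine ⟨v - Pi.single i 1, ?_⟩
      ext j
      by_cases hj : j = i
      · subst hj
        simp; omega
      · simp [Pi.single_eq_of_ne hj]
  calc (n : ℝ) * poissonOrderKWeight k lam n
      = ∑' v, ∑ i : Fin k, (((i : ℕ) + 1 : ℝ)) * (if s v = n then (v i : ℝ) * w v else 0) := by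
        rw [hW, ← tsum_mul_left]
        refine tsum_congr fun v => ?_
        split_ifs with h
        · rw [← h]
          simp only [hs]
          push_cast
          rw [Finset.sum_mul]
          exact Finset.sum_congr rfl fun i _ => by ring
        · simp
    _ = ∑ i : Fin k, (((i : ℕ) + 1 : ℝ)) * ∑' v, (if s v = n then (v i : ℝ) * w v else 0) := by
        rw [Summable.tsum_finsetSum fun i _ => (hsum n _).mul_left _]
        simp only [tsum_mul_left]
    _ = _ := by
        rw [Finset.mul_sum]
        refine Finset.sum_congr rfl fun i _ => ?_
        rw [hstep]
        split_ifs <;> ring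

/-- The exponent `Σ (1 - cos jt)` of the modulus of the characteristic function. -/
noncomputable def cosDefect (k : ℕ) (t : ℝ) : ℝ :=
  ∑ i ∈ Finset.range k, (1 - Real.cos ((i + 1) * t))

/-- The phase correction `Σ (jt - sin jt)` of the characteristic function. -/
noncomputable def sinDefect (k : ℕ) (t : ℝ) : ℝ :=
  ∑ i ∈ Finset.range k, ((i + 1) * t - Real.sin ((i + 1) * t))

theorem sum_range_succ_cast (k : ℕ) : ∑ i ∈ Finset.range k, ((i : ℝ) + 1) = k * (k + 1) / 2 := by
  induction k with
  | zero => simp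
  | succ k ih => rw [Finset.sum_range_succ, ih]; push_cast; ring

theorem hasSum_poissonOrderKPmf (k : ℕ) (lam : ℝ) : HasSum (poissonOrderKPmf k lam) 1 := by
  have h := hasSum_poissonOrderKWeight k lam 1
  simp only [one_pow, mul_one, Finset.sum_const, Finset.card_univ, Fintype.card_fin,
    nsmul_eq_mul] at h
  have h2 : HasSum (poissonOrderKWeight k lam) (Real.exp (lam * k)) := by
    rw [← Complex.hasSum_ofReal]
    push_cast
    exact h
  have h3 := h2.mul_left (Real.exp (-(k * lam)))
  rw [← Real.exp_add, mul_comm lam, neg_add_cancel, Real.exp_zero] at h3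
  exact h3

theorem poissonOrderKPmf_nonneg (k : ℕ) {lam : ℝ} (h : 0 ≤ lam) (n : ℕ) :
    0 ≤ poissonOrderKPmf k lam n :=
  mul_nonneg (Real.exp_pos _).le (poissonOrderKWeight_nonneg k h n)

theorem summable_mul_poissonOrderKPmf (k : ℕ) {lam : ℝ} (h : 0 ≤ lam) :
    Summable fun n : ℕ => (n : ℝ) * poissonOrderKPmf k lam n := by
  have h1 : Summable fun n : ℕ => (poissonOrderKWeight k lam n : ℝ) * 2 ^ n := by
    have := (hasSum_poissonOrderKWeight k lam 2).summable
    rw [← Complex.summable_ofReal]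
    push_cast
    exact this
  refine Summable.of_nonneg_of_le (fun n => mul_nonneg n.cast_nonneg
    (poissonOrderKPmf_nonneg k h n)) (fun n => ?_) (h1.mul_left (Real.exp (-(k * lam))))
  rw [poissonOrderKPmf_eq]
  have h2 : (n : ℝ) ≤ 2 ^ n := by exact_mod_cast n.lt_two_pow_self.le
  have h3 := mul_le_mul_of_nonneg_left h2 (poissonOrderKPmf_nonneg k h n)
  rw [poissonOrderKPmf_eq] at h3
  linarith

theorem hasSum_poissonOrderKPmf_mul_sin (k : ℕ) (lam s t : ℝ) :
    HasSum (fun n : ℕ => poissonOrderKPmf k lam n * Real.sin ((n - s) * t))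
      (Real.exp (-(lam * cosDefect k t)) *
        Real.sin ((lam * (k * (k + 1) / 2) - s) * t - lam * sinDefect k t)) := by
  have h := hasSum_poissonOrderKWeight k lam (Complex.exp (t * Complex.I))
  have h1 := h.mul_left (Complex.exp (-(k * lam) + (-(s * t) : ℝ) * Complex.I))
  have h2 := Complex.hasSum_im h1
  convert h2 using 1
  · funext n
    rw [poissonOrderKPmf_eq, ← Complex.exp_nat_mul, mul_left_comm, ← Complex.exp_add]
    have : -((k : ℂ) * lam) + ((-(s * t) : ℝ) : ℂ) * Complex.I + n * (t * Complex.I) =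
        ((-(k * lam) : ℝ) : ℂ) + (((n - s) * t : ℝ) : ℂ) * Complex.I := by
      push_cast; ring
    rw [this, Complex.im_ofReal_mul, Complex.exp_im]
    simp
    ring
  · rw [← Complex.exp_add]
    have e : ∑ i : Fin k, Complex.exp (t * Complex.I) ^ ((i : ℕ) + 1) =
        ((k - cosDefect k t : ℝ) : ℂ) +
          ((k * (k + 1) / 2 * t - sinDefect k t : ℝ) : ℂ) * Complex.I := by
      rw [Fin.sum_univ_eq_sum_range (fun i => Complex.exp (t * Complex.I) ^ (i + 1)),
        ← sum_range_succ_cast]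
      have c1 : (k : ℝ) - cosDefect k t = ∑ i ∈ Finset.range k, Real.cos ((i + 1) * t) := by
        simp [cosDefect]
      have c2 : (∑ i ∈ Finset.range k, ((i : ℝ) + 1)) * t - sinDefect k t =
          ∑ i ∈ Finset.range k, Real.sin ((i + 1) * t) := by
        simp only [sinDefect, Finset.sum_sub_distrib, Finset.sum_mul]
        ring
      rw [c1, c2]
      push_cast
      rw [Finset.sum_mul, ← Finset.sum_add_distrib]
      refine Finset.sum_congr rfl fun i _ => ?_
      rw [← Complex.exp_nat_mul, ← Complex.exp_mul_I]
      congr 1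
      push_cast
      ring
    rw [e]
    have : -((k : ℂ) * lam) + ((-(s * t) : ℝ) : ℂ) * Complex.I + lam *
        (((k - cosDefect k t : ℝ) : ℂ) +
          ((k * (k + 1) / 2 * t - sinDefect k t : ℝ) : ℂ) * Complex.I) =
        ((-(lam * cosDefect k t) : ℝ) : ℂ) +
        (((lam * (k * (k + 1) / 2) - s) * t - lam * sinDefect k t : ℝ) : ℂ) * Complex.I := by
      push_cast; ring
    rw [this, Complex.exp_im]
    simp

theorem one_add_two_mul_sum_cos_mul_sin (l : ℕ) (t : ℝ) :
    (1 + 2 * ∑ j ∈ Finset.range l, Real.cos ((j + 1) * t)) * Real.sin (t / 2) =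
      Real.sin ((l + 1 / 2) * t) := by
  induction l with
  | zero => simp; ring_nf
  | succ l ih =>
    rw [Finset.sum_range_succ, mul_add, ← add_assoc, add_mul, ih]
    have h1 : ((l + 1 : ℕ) + 1 / 2 : ℝ) * t = (l + 1) * t + t / 2 := by push_cast; ring
    have h2 : ((l : ℝ) + 1 / 2) * t = (l + 1) * t - t / 2 := by ring
    rw [h1, h2, Real.sin_add, Real.sin_sub]
    ring

theorem integral_one_add_two_mul_sum_cos (l : ℕ) :
    ∫ t in (0 : ℝ)..Real.pi, (1 + 2 * ∑ j ∈ Finset.range l, Real.cos ((j + 1) * t)) = Real.pi := by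
  rw [intervalIntegral.integral_add (by simp) (Continuous.intervalIntegrable (by fun_prop) _ _),
    intervalIntegral.integral_const_mul, intervalIntegral.integral_finsetSum
      (fun i _ => Continuous.intervalIntegrable (by fun_prop) _ _)]
  have : ∀ j : ℕ, ∫ t in (0 : ℝ)..Real.pi, Real.cos ((j + 1) * t) = 0 := fun j => by
    have hj : (j : ℝ) + 1 ≠ 0 := by positivity
    rw [intervalIntegral.integral_comp_mul_left (fun x => Real.cos x) hj, integral_cos]
    have := Real.sin_nat_mul_pi (j + 1)
    push_cast at this
    simp [this]
  simp [this]

/-- The inversion integral for the distribution function at `m`. -/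
theorem integral_exp_mul_sin_div_sin (k : ℕ) {lam : ℝ} (h : 0 ≤ lam) (m : ℕ) :
    ∫ t in (0 : ℝ)..Real.pi, Real.exp (-(lam * cosDefect k t)) *
        Real.sin ((lam * (k * (k + 1) / 2) - (m + 1 / 2)) * t - lam * sinDefect k t) /
          Real.sin (t / 2) =
      Real.pi * (1 - 2 * ∑ j ∈ Finset.range (m + 1), poissonOrderKPmf k lam j) := by
  set c := poissonOrderKPmf k lam with hc
  have hc0 : ∀ n, 0 ≤ c n := poissonOrderKPmf_nonneg k h
  let D : ℕ → ℝ → ℝ := fun l t => 1 + 2 * ∑ j ∈ Finset.range l, Real.cos ((j + 1) * t)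
  let l : ℕ → ℕ := fun n => if n ≤ m then m - n else n - m - 1
  let sg : ℕ → ℝ := fun n => if n ≤ m then -1 else 1
  have hD : ∀ n t, sg n * D (l n) t * Real.sin (t / 2) = Real.sin ((n - (m + 1 / 2)) * t) := by
    intro n t
    simp only [D, sg, l, mul_assoc, one_add_two_mul_sum_cos_mul_sin]
    split_ifs with hn
    · rw [neg_one_mul, ← Real.sin_neg, Nat.cast_sub hn]
      ring_nf
    · have : m + 1 ≤ n := by omega
      rw [one_mul, Nat.sub_sub, Nat.cast_sub this]
      push_cast
      ring_nf
  have hDb : ∀ n t, |D (l n) t| ≤ 2 * (n + m) + 1 := by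
    intro n t
    have h1 : |∑ j ∈ Finset.range (l n), Real.cos ((j + 1) * t)| ≤ (l n : ℝ) := by
      refine (Finset.abs_sum_le_sum_abs _ _).trans ?_
      refine (Finset.sum_le_sum fun j _ => Real.abs_cos_le_one _).trans ?_
      simp
    have h2 : (l n : ℝ) ≤ n + m := by
      have : l n ≤ n + m := by simp only [l]; split_ifs <;> omega
      exact_mod_cast this
    rw [abs_le] at h1 ⊢
    constructor <;> simp only [D] <;> linarith
  have hsg : ∀ n, |sg n| = 1 := fun n => by simp only [sg]; split_ifs <;> simp
  have hcont : ∀ n, Continuous (D n) := fun n => by simp only [D]; fun_prop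
  have hsum : Summable fun n : ℕ => c n * (2 * (n + m) + 1) := by
    have h1 := (summable_mul_poissonOrderKPmf k h).mul_left 2
    have h2 := (hasSum_poissonOrderKPmf k lam).summable.mul_left (2 * m + 1 : ℝ)
    refine (h1.add h2).congr fun n => ?_
    rw [← hc]
    ring
  have key := intervalIntegral.hasSum_integral_of_dominated_convergence
    (μ := MeasureTheory.volume) (a := 0) (b := Real.pi)
    (F := fun n t => c n * (sg n * D (l n) t))
    (f := fun t => Real.exp (-(lam * cosDefect k t)) *
        Real.sin ((lam * (k * (k + 1) / 2) - (m + 1 / 2)) * t - lam * sinDefect k t) /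
          Real.sin (t / 2))
    (fun n _ => c n * (2 * (n + m) + 1))
    (fun n => (Continuous.aestronglyMeasurable (by have := hcont (l n); fun_prop)))
    (fun n => Filter.Eventually.of_forall fun t _ => by
      rw [Real.norm_eq_abs, abs_mul, abs_mul, hsg, abs_of_nonneg (hc0 n), one_mul]
      exact mul_le_mul_of_nonneg_left (hDb n t) (hc0 n))
    (Filter.Eventually.of_forall fun t _ => hsum)
    (by simp)
    (Filter.Eventually.of_forall fun t ht => by
      rw [Set.uIoc_of_le Real.pi_pos.le] at ht
      have hs : Real.sin (t / 2) ≠ 0 := by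
        refine (Real.sin_pos_of_pos_of_lt_pi ?_ ?_).ne' <;> linarith [ht.1, ht.2, Real.pi_pos]
      have h1 := (hasSum_poissonOrderKPmf_mul_sin k lam (m + 1 / 2) t).div_const (Real.sin (t / 2))
      refine h1.congr_fun fun n => ?_
      rw [← hD, ← hc, mul_div_assoc, mul_div_cancel_right₀ _ hs])
  refine key.unique ?_
  have hI : ∀ n, ∫ t in (0 : ℝ)..Real.pi, c n * (sg n * D (l n) t) = Real.pi * (c n * sg n) := by
    intro n
    rw [intervalIntegral.integral_const_mul, intervalIntegral.integral_const_mul,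
      integral_one_add_two_mul_sum_cos]
    ring
  simp only [hI]
  refine HasSum.mul_left _ ?_
  have h1 : HasSum (fun n => if n ∈ Finset.range (m + 1) then c n else 0)
      (∑ j ∈ Finset.range (m + 1), c j) := by
    rw [← Finset.sum_congr rfl fun j (hj : j ∈ Finset.range (m + 1)) => if_pos (e := 0) hj]
    exact hasSum_sum_of_ne_finset_zero fun n hn => if_neg hn
  have h2 := (hasSum_poissonOrderKPmf k lam).sub (h1.mul_left 2)
  refine h2.congr_fun fun n => ?_
  simp only [sg, Finset.mem_range, Nat.lt_succ_iff, ← hc]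
  split_ifs <;> ring

theorem poissonOrderKMedian_eq {k : ℕ} {lam : ℝ} (h : 0 ≤ lam) {m : ℕ}
    (h1 : 1 / 2 ≤ ∑ j ∈ Finset.range (m + 1), poissonOrderKPmf k lam j)
    (h2 : ∑ j ∈ Finset.range m, poissonOrderKPmf k lam j < 1 / 2) :
    poissonOrderKMedian k lam = m := by
  refine le_antisymm (Nat.sInf_le h1) (le_csInf ⟨m, h1⟩ fun b hb => ?_)
  by_contra hlt
  refine absurd (hb.trans (Finset.sum_le_sum_of_subset_of_nonneg
    (Finset.range_subset_range.2 (show b + 1 ≤ m by omega)) fun i _ _ => poissonOrderKPmf_nonneg k h i)) ?_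
  exact not_le.2 h2

/-- Apply `f` to `x` after forcing the kernel to evaluate `x`. -/
def forceNat {α : Type} (x : ℕ) (f : ℕ → α) : α :=
  Nat.rec (f 0) (fun n _ => f (Nat.succ n)) x

theorem forceNat_eq {α : Type} (x : ℕ) (f : ℕ → α) : forceNat x f = f x := by
  cases x <;> rfl

/-- A block of steps of the rounded Panjer recursion with parameter `a / b`; the list argument
holds the prefix sums from `k` steps ago. -/
def panjerBlock (a b k : ℕ) (cont : ℕ → ℕ → ℕ → ℕ → List ℕ → Bool) :
    List ℕ → ℕ → ℕ → ℕ → ℕ → List ℕ → Bool :=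
  fun l => List.rec (fun d0 S C bm acc => cont d0 S C bm acc)
    (fun d _ ih d0 S C bm acc =>
      forceNat (Nat.sub (Nat.add S C) (Nat.add d (Nat.mul k (Nat.sub d d0)))) fun S1 =>
      forceNat (Nat.add bm b) fun bm1 =>
      forceNat (Nat.add C (Nat.div (Nat.mul a S1) bm1)) fun C1 =>
      ih d S1 C1 bm1 (List.cons C acc)) l

theorem panjerBlock_cons (a b k : ℕ) (cont : ℕ → ℕ → ℕ → ℕ → List ℕ → Bool)
    (d : ℕ) (l : List ℕ) (d0 S C bm : ℕ) (acc : List ℕ) :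
    panjerBlock a b k cont (d :: l) d0 S C bm acc =
      panjerBlock a b k cont l d (S + C - (d + k * (d - d0)))
        (C + a * (S + C - (d + k * (d - d0))) / (bm + b)) (bm + b) (C :: acc) := by
  simp only [panjerBlock, forceNat_eq]
  rfl

/-- `i` full blocks followed by one block of length `r`. -/
def panjerRun (a b k r : ℕ) (fin : ℕ → List ℕ → Bool) :
    ℕ → ℕ → ℕ → ℕ → ℕ → List ℕ → Bool := fun i =>
  Nat.rec
    (fun d0 S C bm acc => panjerBlock a b k (fun _ _ C _ acc => fin C acc)
      (List.take r (List.reverse acc)) d0 S C bm List.nil)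
    (fun _ ih d0 S C bm acc => panjerBlock a b k ih (List.reverse acc) d0 S C bm List.nil) i

theorem panjerRun_zero (a b k r : ℕ) (fin : ℕ → List ℕ → Bool) (d0 S C bm : ℕ) (acc : List ℕ) :
    panjerRun a b k r fin 0 d0 S C bm acc = panjerBlock a b k (fun _ _ C _ acc => fin C acc)
      (List.take r (List.reverse acc)) d0 S C bm List.nil := rfl

theorem panjerRun_succ (a b k r : ℕ) (fin : ℕ → List ℕ → Bool) (i d0 S C bm : ℕ)
    (acc : List ℕ) :
    panjerRun a b k r fin (i + 1) d0 S C bm acc =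
      panjerBlock a b k (panjerRun a b k r fin i) (List.reverse acc) d0 S C bm List.nil := rfl

/-- The rounded weights. -/
def panjerSeq (a b k s : ℕ) : ℕ → ℕ
  | 0 => s
  | m + 1 => a * (∑ i : Fin k, if (i : ℕ) ≤ m then (i + 1) * panjerSeq a b k s (m - i) else 0) /
      (b * (m + 1))
  decreasing_by omega

/-- The convolution sum entering the recursion. -/
def panjerConv (x : ℕ → ℕ) (k m : ℕ) : ℕ :=
  ∑ i ∈ Finset.range k, if i + 1 ≤ m then (i + 1) * x (m - (i + 1)) else 0

theorem panjerSeq_succ (a b k s m : ℕ) : panjerSeq a b k s (m + 1) =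
    a * panjerConv (panjerSeq a b k s) k (m + 1) / (b * (m + 1)) := by
  rw [panjerSeq, panjerConv, Finset.sum_range]
  simp [Nat.add_sub_add_right]

theorem panjerConv_succ (x : ℕ → ℕ) (k m : ℕ) :
    panjerConv x k (m + 1) + (k + 1) * ∑ j ∈ Finset.range (m + 1 - k), x j =
      panjerConv x k m + ∑ j ∈ Finset.range (m + 1), x j +
        k * ∑ j ∈ Finset.range (m - k), x j := by
  induction k with
  | zero => simp [panjerConv]
  | succ k ih =>
    have e1 : panjerConv x (k + 1) (m + 1) =
        panjerConv x k (m + 1) + if k ≤ m then (k + 1) * x (m - k) else 0 := by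
      rw [panjerConv, Finset.sum_range_succ]
      simp [panjerConv, Nat.add_sub_add_right]
    have e2 : panjerConv x (k + 1) m =
        panjerConv x k m + if k + 1 ≤ m then (k + 1) * x (m - (k + 1)) else 0 := by
      rw [panjerConv, Finset.sum_range_succ]
      rfl
    rw [e1, e2, Nat.add_sub_add_right]
    rcases lt_trichotomy k m with h | h | h
    · obtain ⟨d, rfl⟩ : ∃ d, m = k + 1 + d := ⟨m - (k + 1), by omega⟩
      rw [if_pos (by omega), if_pos (by omega)]
      rw [show k + 1 + d + 1 - k = d + 1 + 1 by omega, show k + 1 + d - k = d + 1 by omega] at ih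
      rw [show k + 1 + d - k = d + 1 by omega, show k + 1 + d - (k + 1) = d by omega]
      rw [Finset.sum_range_succ _ (d + 1), Finset.sum_range_succ _ d] at ih
      rw [Finset.sum_range_succ _ d]
      linarith
    · subst h
      rw [if_pos le_rfl, if_neg (by omega)]
      rw [show k + 1 - k = 1 by omega] at ih
      simp at ih ⊢
      linarith
    · rw [if_neg (by omega), if_neg (by omega)]
      rw [show m + 1 - k = 0 by omega, show m - k = 0 by omega] at ih
      rw [show m - k = 0 by omega, show m - (k + 1) = 0 by omega]
      simpa using ih

section
variable (a b k s : ℕ)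

/-- Prefix sums of the rounded weights. -/
def panjerSum (m : ℕ) : ℕ := ∑ j ∈ Finset.range m, panjerSeq a b k s j

theorem panjerSum_mono : Monotone (panjerSum a b k s) := fun _ _ h =>
  Finset.sum_le_sum_of_subset (Finset.range_subset_range.2 h)

theorem panjerConv_succ_eq (m : ℕ) :
    panjerConv (panjerSeq a b k s) k (m + 1) =
      panjerConv (panjerSeq a b k s) k m + panjerSum a b k s (m + 1) -
        (panjerSum a b k s (m + 1 - k) +
          k * (panjerSum a b k s (m + 1 - k) - panjerSum a b k s (m - k))) := by
  have h := panjerConv_succ (panjerSeq a b k s) k m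
  have h1 := panjerSum_mono a b k s (show m - k ≤ m + 1 - k by omega)
  simp only [panjerSum] at h1 ⊢
  generalize ∑ j ∈ Finset.range (m + 1 - k), panjerSeq a b k s j = u at *
  generalize ∑ j ∈ Finset.range (m - k), panjerSeq a b k s j = v at *
  obtain ⟨d, rfl⟩ := Nat.exists_eq_add_of_le h1
  rw [Nat.add_sub_cancel_left]
  have : (k + 1) * (v + d) = v + d + k * d + k * v := by ring
  omega

theorem panjerBlock_eq (cont : ℕ → ℕ → ℕ → ℕ → List ℕ → Bool) (L m : ℕ) (acc : List ℕ) :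
    panjerBlock a b k cont ((List.range' m L).map fun i => panjerSum a b k s (i + 1 - k))
        (panjerSum a b k s (m - k)) (panjerConv (panjerSeq a b k s) k m)
        (panjerSum a b k s (m + 1)) (b * m) acc =
      cont (panjerSum a b k s (m + L - k)) (panjerConv (panjerSeq a b k s) k (m + L))
        (panjerSum a b k s (m + L + 1)) (b * (m + L))
        (((List.range' m L).map fun i => panjerSum a b k s (i + 1)).reverse ++ acc) := by
  induction L generalizing m acc with
  | zero => rfl
  | succ L ih =>
    rw [List.range'_succ, List.map_cons, panjerBlock_cons, ← panjerConv_succ_eq, List.map_cons,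
      List.reverse_cons, List.append_assoc, List.singleton_append,
      show m + (L + 1) = m + 1 + L by ring, ← ih (m + 1)]
    have e2 : panjerSum a b k s (m + 1 + 1) = panjerSum a b k s (m + 1) +
        a * panjerConv (panjerSeq a b k s) k (m + 1) / (b * (m + 1)) := by
      rw [← panjerSeq_succ, panjerSum, Finset.sum_range_succ]; rfl
    rw [e2, mul_add, mul_one]

theorem panjerRun_eq (fin : ℕ → List ℕ → Bool) (r i m : ℕ) (hrk : r ≤ k) :
    panjerRun a b k r fin i (panjerSum a b k s (m - k)) (panjerConv (panjerSeq a b k s) k m)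
        (panjerSum a b k s (m + 1)) (b * m)
        ((List.range' m k).map fun i => panjerSum a b k s (i + 1 - k)).reverse =
      fin (panjerSum a b k s (m + i * k + r + 1))
        ((List.range' (m + i * k) r).map fun i => panjerSum a b k s (i + 1)).reverse := by
  induction i generalizing m with
  | zero =>
    have e : List.take r (List.range' m k) = List.range' m r := by
      rw [List.take_range'_of_length_ge hrk]
    rw [panjerRun_zero, List.reverse_reverse, ← List.map_take, e, panjerBlock_eq]
    simp
  | succ i ih =>
    rw [panjerRun_succ, List.reverse_reverse, panjerBlock_eq]
    have e : (List.range' m k).map (fun i => panjerSum a b k s (i + 1)) =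
        (List.range' (m + k) k).map fun i => panjerSum a b k s (i + 1 - k) := by
      rw [List.range'_eq_map_range, List.range'_eq_map_range, List.map_map, List.map_map]
      refine List.map_congr_left fun i _ => ?_
      simp only [Function.comp_apply]
      congr 1
      omega
    rw [e, List.append_nil, ih, show m + k + i * k = m + (i + 1) * k by ring]
end

theorem poissonOrderKWeight_succ (k : ℕ) (lam : ℝ) (m : ℕ) :
    ((m : ℝ) + 1) * poissonOrderKWeight k lam (m + 1) =
      lam * ∑ i ∈ Finset.range k, if i ≤ m then
        ((i : ℝ) + 1) * poissonOrderKWeight k lam (m - i) else 0 := by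
  have h := poissonOrderKWeight_rec k lam (m + 1)
  rw [Finset.sum_range]
  simpa [Nat.add_sub_add_right] using h

theorem panjerConv_succ_cast (x : ℕ → ℕ) (k m : ℕ) : (panjerConv x k (m + 1) : ℝ) =
    ∑ i ∈ Finset.range k, if i ≤ m then ((i : ℝ) + 1) * x (m - i) else 0 := by
  rw [panjerConv]
  push_cast
  simp

theorem panjerSeq_le (a b k s : ℕ) (m : ℕ) :
    (panjerSeq a b k s m : ℝ) ≤ s * poissonOrderKWeight k (a / b) m := by
  induction m using Nat.strong_induction_on with
  | _ m ih =>
  rcases m with _ | m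
  · simp [panjerSeq, poissonOrderKWeight_zero]
  · have h1 : (panjerSeq a b k s (m + 1) : ℝ) ≤
        a * panjerConv (panjerSeq a b k s) k (m + 1) / (b * (m + 1)) := by
      rw [panjerSeq_succ]
      exact Nat.cast_div_le.trans (by push_cast; rfl)
    have hm : (0 : ℝ) < m + 1 := by positivity
    refine le_of_mul_le_mul_left ?_ hm
    calc ((m : ℝ) + 1) * panjerSeq a b k s (m + 1)
        ≤ (m + 1) * (a * panjerConv (panjerSeq a b k s) k (m + 1) / (b * (m + 1))) :=
          mul_le_mul_of_nonneg_left h1 hm.le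
      _ = a / b * panjerConv (panjerSeq a b k s) k (m + 1) := by
          rw [mul_comm (b : ℝ), ← div_div, ← mul_div_assoc, ← mul_div_assoc,
            mul_div_cancel_left₀ _ hm.ne']
          ring
      _ ≤ a / b * ∑ i ∈ Finset.range k, if i ≤ m then
            ((i : ℝ) + 1) * (s * poissonOrderKWeight k (a / b) (m - i)) else 0 := by
          rw [panjerConv_succ_cast]
          refine mul_le_mul_of_nonneg_left (Finset.sum_le_sum fun i _ => ?_) (by positivity)
          split_ifs with h
          · exact mul_le_mul_of_nonneg_left (ih _ (by omega)) (by positivity)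
          · rfl
      _ = s * ((m + 1) * poissonOrderKWeight k (a / b) (m + 1)) := by
          rw [poissonOrderKWeight_succ, mul_left_comm (s : ℝ), Finset.mul_sum _ _ (s : ℝ)]
          congr 1
          refine Finset.sum_congr rfl fun i _ => ?_
          split_ifs <;> ring
      _ = _ := by ring

theorem one_le_poissonOrderKWeight {k : ℕ} {lam : ℝ} (h : 1 ≤ lam) {m : ℕ}
    (hm : (m : ℝ) ≤ lam * (k * (k + 1) / 2)) : 1 ≤ poissonOrderKWeight k lam m := by
  induction m using Nat.strong_induction_on with
  | _ m ih =>
  rcases m with _ | m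
  · simp [poissonOrderKWeight_zero]
  · have hm0 : (0 : ℝ) < m + 1 := by positivity
    refine le_of_mul_le_mul_left ?_ hm0
    rw [poissonOrderKWeight_succ, mul_one]
    have h1 : ∑ i ∈ Finset.range (min k (m + 1)), ((i : ℝ) + 1) ≤
        ∑ i ∈ Finset.range k, if i ≤ m then
          ((i : ℝ) + 1) * poissonOrderKWeight k lam (m - i) else 0 := by
      calc ∑ i ∈ Finset.range (min k (m + 1)), ((i : ℝ) + 1)
          ≤ ∑ i ∈ Finset.range (min k (m + 1)), if i ≤ m then
              ((i : ℝ) + 1) * poissonOrderKWeight k lam (m - i) else 0 := by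
            refine Finset.sum_le_sum fun i hi => ?_
            rw [Finset.mem_range, lt_min_iff] at hi
            rw [if_pos (by omega)]
            refine le_mul_of_one_le_right (by positivity) (ih _ (by omega) (hm.trans' ?_))
            exact_mod_cast (by omega : m - i ≤ m + 1)
        _ ≤ _ := Finset.sum_le_sum_of_subset_of_nonneg
            (Finset.range_subset_range.2 (min_le_left _ _)) fun i _ _ => by
              have := poissonOrderKWeight_nonneg k (zero_le_one.trans h) (m - i)
              split_ifs <;> positivity
    refine le_trans ?_ (mul_le_mul_of_nonneg_left h1 (zero_le_one.trans h))
    rw [sum_range_succ_cast]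
    rcases le_total k (m + 1) with hk | hk
    · rw [min_eq_left hk]
      push_cast at hm
      exact hm
    · rw [min_eq_right hk]
      push_cast
      have : (0 : ℝ) ≤ m := m.cast_nonneg
      refine le_trans ?_ (le_mul_of_one_le_left (by positivity) h)
      nlinarith

theorem le_panjerSeq_add {a b k s n : ℕ} (hb : 0 < b) (hab : b ≤ a)
    (hn : (n : ℝ) ≤ (a / b : ℝ) * (k * (k + 1) / 2)) {m : ℕ} (hm : m ≤ n) :
    s * poissonOrderKWeight k (a / b) m ≤
      panjerSeq a b k s m + m * poissonOrderKWeight k (a / b) m := by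
  have hb0 : (0 : ℝ) < b := by exact_mod_cast hb
  have hlam : (1 : ℝ) ≤ a / b := by
    rw [le_div_iff₀ hb0]; exact_mod_cast (by omega : 1 * b ≤ a)
  induction m using Nat.strong_induction_on with
  | _ m ih =>
  rcases m with _ | m
  · simp [panjerSeq, poissonOrderKWeight_zero]
  · have hm0 : (0 : ℝ) < m + 1 := by positivity
    have h0 : 1 ≤ poissonOrderKWeight k (a / b) (m + 1) :=
      one_le_poissonOrderKWeight hlam (hn.trans' (by exact_mod_cast hm))
    have h1 : a / b * panjerConv (panjerSeq a b k s) k (m + 1) ≤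
        ((m : ℝ) + 1) * (panjerSeq a b k s (m + 1) + 1) := by
      have h := Nat.lt_div_mul_add (a := a * panjerConv (panjerSeq a b k s) k (m + 1))
        (show 0 < b * (m + 1) by positivity)
      rw [← panjerSeq_succ] at h
      have h' : (a : ℝ) * panjerConv (panjerSeq a b k s) k (m + 1) <
          panjerSeq a b k s (m + 1) * (b * (m + 1)) + b * (m + 1) := by exact_mod_cast h
      rw [div_mul_eq_mul_div, div_le_iff₀ hb0]
      linarith
    have h2 : (a / b : ℝ) * ∑ i ∈ Finset.range k, (if i ≤ m then
            ((i : ℝ) + 1) * ((s - m) * poissonOrderKWeight k (a / b) (m - i)) else 0) ≤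
        a / b * panjerConv (panjerSeq a b k s) k (m + 1) := by
      rw [panjerConv_succ_cast]
      refine mul_le_mul_of_nonneg_left (Finset.sum_le_sum fun i _ => ?_) (by positivity)
      split_ifs with h
      · refine mul_le_mul_of_nonneg_left ?_ (by positivity)
        have h3 := ih (m - i) (by omega) (by omega)
        rw [Nat.cast_sub h] at h3
        have h4 := mul_nonneg (Nat.cast_nonneg (α := ℝ) i)
          (poissonOrderKWeight_nonneg k (zero_le_one.trans hlam) (m - i))
        linarith
      · rfl
    have h3 : (a / b : ℝ) * ∑ i ∈ Finset.range k, (if i ≤ m then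
            ((i : ℝ) + 1) * ((s - m) * poissonOrderKWeight k (a / b) (m - i)) else 0) =
        (s - m) * ((m + 1) * poissonOrderKWeight k (a / b) (m + 1)) := by
      rw [poissonOrderKWeight_succ, mul_left_comm ((s : ℝ) - m), Finset.mul_sum _ _ ((s : ℝ) - m)]
      congr 1
      refine Finset.sum_congr rfl fun i _ => ?_
      split_ifs <;> ring
    have h4 : ((m : ℝ) + 1) * ((s - m) * poissonOrderKWeight k (a / b) (m + 1)) ≤
        ((m : ℝ) + 1) * (panjerSeq a b k s (m + 1) + 1) := by linarith
    have h5 := le_of_mul_le_mul_left h4 hm0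
    push_cast
    linarith

/-- Decides the median for `(k, n)` by running the rounded recursion at scale `s`. -/
def panjerCheck (s k n : ℕ) : Bool :=
  forceNat (n - (k + 4) / 8 - 1) fun N =>
  forceNat (2 * n) fun a =>
  forceNat (k * (k + 1)) fun b =>
  forceNat (N % k + 1) fun r =>
  forceNat (N / k) fun i =>
  panjerRun a b k r (fun C acc =>
    Nat.ble (s ^ (k + 1) * 27182818286 ^ a) ((2 * C) ^ (k + 1) * (10 ^ 10) ^ a) &&
    Nat.ble ((2 * acc.headD 0) ^ (k + 1) * (10 ^ 10) ^ a + 1)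
      ((s - n) ^ (k + 1) * 27182818283 ^ a)) i 0 0 s 0 (List.replicate k 0)

theorem panjerCheck_spec {s k n : ℕ} (hk : 1 ≤ k) (hn : k * (k + 1) / 2 ≤ n)
    (h : panjerCheck s k n = true) :
    s ^ (k + 1) * 27182818286 ^ (2 * n) ≤
        (2 * panjerSum (2 * n) (k * (k + 1)) k s (n - (k + 4) / 8 + 1)) ^ (k + 1) *
          (10 ^ 10) ^ (2 * n) ∧
      (2 * panjerSum (2 * n) (k * (k + 1)) k s (n - (k + 4) / 8)) ^ (k + 1) *
          (10 ^ 10) ^ (2 * n) < (s - n) ^ (k + 1) * 27182818283 ^ (2 * n) := by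
  have hM : (k + 4) / 8 < n := by
    have : k ≤ k * (k + 1) / 2 := by
      rw [Nat.le_div_iff_mul_le (by norm_num)]
      nlinarith
    omega
  simp only [panjerCheck, forceNat_eq] at h
  have e := panjerRun_eq (2 * n) (k * (k + 1)) k s (fun C acc =>
    Nat.ble (s ^ (k + 1) * 27182818286 ^ (2 * n)) ((2 * C) ^ (k + 1) * (10 ^ 10) ^ (2 * n)) &&
    Nat.ble ((2 * acc.headD 0) ^ (k + 1) * (10 ^ 10) ^ (2 * n) + 1)
      ((s - n) ^ (k + 1) * 27182818283 ^ (2 * n))) ((n - (k + 4) / 8 - 1) % k + 1)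
      ((n - (k + 4) / 8 - 1) / k) 0 (Nat.mod_lt _ hk)
  have e1 : (List.range' 0 k).map (fun i => panjerSum (2 * n) (k * (k + 1)) k s (i + 1 - k)) =
      List.replicate k 0 := by
    refine List.eq_replicate_iff.2 ⟨by simp, fun x hx => ?_⟩
    obtain ⟨i, hi, rfl⟩ := List.mem_map.1 hx
    rw [List.mem_range'_1] at hi
    rw [show i + 1 - k = 0 by omega]
    rfl
  have e2 : panjerSum (2 * n) (k * (k + 1)) k s (0 + 1) = s := by
    simp [panjerSum, panjerSeq]
  have e3 : panjerSum (2 * n) (k * (k + 1)) k s (0 - k) = 0 := by simp [panjerSum]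
  have e4 : panjerConv (panjerSeq (2 * n) (k * (k + 1)) k s) k 0 = 0 := by simp [panjerConv]
  rw [e1, e2, e3, e4, mul_zero, List.reverse_replicate] at e
  rw [e] at h
  have hdm := Nat.div_add_mod (n - (k + 4) / 8 - 1) k
  rw [mul_comm] at hdm
  set r := (n - (k + 4) / 8 - 1) % k
  set i := (n - (k + 4) / 8 - 1) / k
  rw [Bool.and_eq_true, Nat.ble_eq, Nat.ble_eq, List.range'_1_concat, List.map_append,
    List.reverse_append] at h
  simp only [List.map_cons, List.map_nil, List.reverse_singleton, List.singleton_append,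
    List.headD_cons] at h
  rw [show 0 + i * k + (r + 1) + 1 = n - (k + 4) / 8 + 1 by omega,
    show 0 + i * k + r + 1 = n - (k + 4) / 8 by omega] at h
  exact h

theorem poissonOrderKMedian_of_panjerCheck {s k n : ℕ} (hk : 1 ≤ k) (hn : k * (k + 1) / 2 ≤ n)
    (hs : n < s) (h : panjerCheck s k n = true) :
    poissonOrderKMedian k ((n : ℝ) / ((k * (k + 1) / 2 : ℕ) : ℝ)) = n - (k + 4) / 8 := by
  obtain ⟨h1, h2⟩ := panjerCheck_spec hk hn h
  have h2k : 2 ∣ k * (k + 1) := (Nat.even_mul_succ_self k).two_dvd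
  have hlam : (n : ℝ) / ((k * (k + 1) / 2 : ℕ) : ℝ) = ((2 * n : ℕ) : ℝ) / (k * (k + 1) : ℕ) := by
    rw [Nat.cast_div h2k (by norm_num)]
    push_cast
    field_simp
  have hk0 : (0 : ℝ) < k := by exact_mod_cast hk
  have hkl : (k : ℝ) * (((2 * n : ℕ) : ℝ) / (k * (k + 1) : ℕ)) = (2 * n : ℕ) / (k + 1 : ℕ) := by
    push_cast
    field_simp
  have hmean : (n : ℝ) ≤ (((2 * n : ℕ) : ℝ) / (k * (k + 1) : ℕ)) * (k * (k + 1) / 2) := by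
    refine le_of_eq ?_
    push_cast
    field_simp
  have hb : 0 < k * (k + 1) := by positivity
  have hab : k * (k + 1) ≤ 2 * n := by omega
  rw [hlam]
  have hl0 : (0 : ℝ) ≤ ((2 * n : ℕ) : ℝ) / (k * (k + 1) : ℕ) := by positivity
  set lam := ((2 * n : ℕ) : ℝ) / (k * (k + 1) : ℕ) with hlamdef
  have hs0 : (0 : ℝ) < s := by exact_mod_cast (by omega : 0 < s)
  have hsn : (0 : ℝ) < s - n := by
    have : (n : ℝ) < s := by exact_mod_cast hs
    linarith
  have hF : ∀ m, ∑ j ∈ Finset.range m, poissonOrderKPmf k lam j =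
      (∑ j ∈ Finset.range m, poissonOrderKWeight k lam j) / Real.exp (k * lam) := fun m => by
    simp only [poissonOrderKPmf_eq, ← Finset.mul_sum]
    rw [Real.exp_neg]
    field_simp
  have hexp : Real.exp (k * lam) ^ (k + 1) = Real.exp 1 ^ (2 * n) := by
    rw [hkl, ← Real.exp_nat_mul, ← Real.exp_nat_mul]
    congr 1
    have : ((k + 1 : ℕ) : ℝ) ≠ 0 := by positivity
    field_simp
  have hE := Real.exp_pos (k * lam)
  have key1 : s * Real.exp (k * lam) ≤
      2 * panjerSum (2 * n) (k * (k + 1)) k s (n - (k + 4) / 8 + 1) := by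
    refine le_of_pow_le_pow_left₀ (Nat.succ_ne_zero k) (by positivity) ?_
    rw [mul_pow, hexp]
    have h1' : (s : ℝ) ^ (k + 1) * 27182818286 ^ (2 * n) ≤
        (2 * panjerSum (2 * n) (k * (k + 1)) k s (n - (k + 4) / 8 + 1)) ^ (k + 1) *
          (10 ^ 10) ^ (2 * n) := by exact_mod_cast h1
    refine le_of_mul_le_mul_right (le_trans ?_ h1')
      (show (0 : ℝ) < (10 ^ 10) ^ (2 * n) by positivity)
    rw [mul_assoc, ← mul_pow]
    gcongr
    have := Real.exp_one_lt_d9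
    norm_num at this ⊢
    linarith
  have key2 : 2 * panjerSum (2 * n) (k * (k + 1)) k s (n - (k + 4) / 8) <
      (s - n) * Real.exp (k * lam) := by
    refine lt_of_pow_lt_pow_left₀ (k + 1) (by positivity) ?_
    rw [mul_pow (_ - _), hexp]
    have h2' : (2 * panjerSum (2 * n) (k * (k + 1)) k s (n - (k + 4) / 8)) ^ (k + 1) *
        (10 ^ 10) ^ (2 * n) < ((s : ℝ) - n) ^ (k + 1) * 27182818283 ^ (2 * n) := by
      rw [← Nat.cast_sub hs.le]
      exact_mod_cast h2
    refine lt_of_mul_lt_mul_right (lt_of_lt_of_le h2' ?_)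
      (show (0 : ℝ) ≤ (10 ^ 10) ^ (2 * n) by positivity)
    rw [mul_assoc, ← mul_pow]
    gcongr
    have := Real.exp_one_gt_d9
    norm_num at this ⊢
    linarith
  refine poissonOrderKMedian_eq hl0 ?_ ?_
  · rw [hF, le_div_iff₀ hE]
    have : (panjerSum (2 * n) (k * (k + 1)) k s (n - (k + 4) / 8 + 1) : ℝ) ≤
        s * ∑ j ∈ Finset.range (n - (k + 4) / 8 + 1), poissonOrderKWeight k lam j := by
      rw [panjerSum, Finset.mul_sum]
      push_cast
      exact Finset.sum_le_sum fun j _ => panjerSeq_le _ _ _ _ _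
    have h3 : s * Real.exp (k * lam) ≤
      s * (2 * ∑ j ∈ Finset.range (n - (k + 4) / 8 + 1), poissonOrderKWeight k lam j) := by linarith
    have := le_of_mul_le_mul_left h3 hs0
    linarith
  · rw [hF, div_lt_iff₀ hE]
    have : ((s : ℝ) - n) * ∑ j ∈ Finset.range (n - (k + 4) / 8), poissonOrderKWeight k lam j ≤
        panjerSum (2 * n) (k * (k + 1)) k s (n - (k + 4) / 8) := by
      rw [panjerSum, Finset.mul_sum]
      push_cast
      refine Finset.sum_le_sum fun j hj => ?_
      have hjn : j ≤ n := by rw [Finset.mem_range] at hj; omega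
      have h3 := le_panjerSeq_add (s := s) hb hab hmean hjn
      have h4 : (j : ℝ) * poissonOrderKWeight k lam j ≤ n * poissonOrderKWeight k lam j :=
        mul_le_mul_of_nonneg_right (by exact_mod_cast hjn) (poissonOrderKWeight_nonneg k hl0 j)
      rw [← hlamdef] at h3
      linarith
    have h3 : ((s : ℝ) - n) * (2 * ∑ j ∈ Finset.range (n - (k + 4) / 8),
        poissonOrderKWeight k lam j) < (s - n) * Real.exp (k * lam) := by linarith
    have := lt_of_mul_lt_mul_left h3 hsn.le
    linarith

/-- `panjerCheck` for all `n` in a range of length `c` starting at `n₀`. -/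
def panjerCheckRange (s k n₀ : ℕ) : ℕ → Bool := fun c =>
  Nat.rec true (fun i ih => panjerCheck s k (n₀ + i) && ih) c

theorem panjerCheck_of_range {s k n₀ c n : ℕ} (h : panjerCheckRange s k n₀ c = true)
    (h1 : n₀ ≤ n) (h2 : n < n₀ + c) : panjerCheck s k n = true := by
  induction c with
  | zero => omega
  | succ c ih =>
    have h' : (panjerCheck s k (n₀ + c) && panjerCheckRange s k n₀ c) = true := h
    rw [Bool.and_eq_true] at h'
    rcases (by omega : n < n₀ + c ∨ n = n₀ + c) with h3 | rfl
    · exact ih h'.2 h3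
    · exact h'.1

theorem nonneg_of_hasDerivAt_nonneg {f f' : ℝ → ℝ} (hf : ∀ x, HasDerivAt f (f' x) x)
    (h0 : f 0 = 0) (hf' : ∀ x, 0 ≤ x → 0 ≤ f' x) {x : ℝ} (hx : 0 ≤ x) : 0 ≤ f x := by
  have hm : MonotoneOn f (Set.Ici 0) := by
    refine monotoneOn_of_deriv_nonneg (convex_Ici 0)
      (fun x _ => (hf x).continuousAt.continuousWithinAt)
      (fun x _ => (hf x).differentiableAt.differentiableWithinAt) fun x hx => ?_
    rw [interior_Ici] at hx
    rw [(hf x).deriv]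
    exact hf' x (le_of_lt hx)
  have := hm Set.self_mem_Ici (Set.mem_Ici.2 hx) hx
  rwa [h0] at this

theorem sub_cube_le_sin {x : ℝ} (hx : 0 ≤ x) : x - x ^ 3 / 6 ≤ Real.sin x := by
  have := nonneg_of_hasDerivAt_nonneg (f := fun x => Real.sin x - (x - x ^ 3 / 6))
    (f' := fun x => Real.cos x - (1 - x ^ 2 / 2)) (fun x => by
      refine HasDerivAt.congr_deriv ((Real.hasDerivAt_sin x).sub ((hasDerivAt_id x).sub ((hasDerivAt_pow 3 x).div_const 6))) ?_
      norm_num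
      try ring) (by simp) (fun x _ => sub_nonneg.2 (Real.one_sub_sq_div_two_le_cos)) hx
  linarith

theorem cos_le_quartic {x : ℝ} (hx : 0 ≤ x) : Real.cos x ≤ 1 - x ^ 2 / 2 + x ^ 4 / 24 := by
  have := nonneg_of_hasDerivAt_nonneg (f := fun x => 1 - x ^ 2 / 2 + x ^ 4 / 24 - Real.cos x)
    (f' := fun x => Real.sin x - (x - x ^ 3 / 6)) (fun x => by
      refine HasDerivAt.congr_deriv (((((hasDerivAt_pow 2 x).div_const 2).const_sub 1).add
        ((hasDerivAt_pow 4 x).div_const 24)).sub (Real.hasDerivAt_cos x)) ?_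
      norm_num
      try ring) (by simp) (fun x hx => sub_nonneg.2 (sub_cube_le_sin hx)) hx
  linarith

theorem sin_le_quintic {x : ℝ} (hx : 0 ≤ x) : Real.sin x ≤ x - x ^ 3 / 6 + x ^ 5 / 120 := by
  have := nonneg_of_hasDerivAt_nonneg (f := fun x => x - x ^ 3 / 6 + x ^ 5 / 120 - Real.sin x)
    (f' := fun x => 1 - x ^ 2 / 2 + x ^ 4 / 24 - Real.cos x) (fun x => by
      refine HasDerivAt.congr_deriv ((((hasDerivAt_id x).sub ((hasDerivAt_pow 3 x).div_const 6)).add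
        ((hasDerivAt_pow 5 x).div_const 120)).sub (Real.hasDerivAt_sin x)) ?_
      norm_num
      try ring) (by simp) (fun x hx => sub_nonneg.2 (cos_le_quartic hx)) hx
  linarith

theorem sextic_le_cos {x : ℝ} (hx : 0 ≤ x) :
    1 - x ^ 2 / 2 + x ^ 4 / 24 - x ^ 6 / 720 ≤ Real.cos x := by
  have := nonneg_of_hasDerivAt_nonneg
    (f := fun x => Real.cos x - (1 - x ^ 2 / 2 + x ^ 4 / 24 - x ^ 6 / 720))
    (f' := fun x => x - x ^ 3 / 6 + x ^ 5 / 120 - Real.sin x) (fun x => by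
      refine HasDerivAt.congr_deriv ((Real.hasDerivAt_cos x).sub (((((hasDerivAt_pow 2 x).div_const 2).const_sub 1).add
        ((hasDerivAt_pow 4 x).div_const 24)).sub ((hasDerivAt_pow 6 x).div_const 720))) ?_
      norm_num
      try ring) (by simp) (fun x hx => sub_nonneg.2 (sin_le_quintic hx)) hx
  linarith

theorem septic_le_sin {x : ℝ} (hx : 0 ≤ x) :
    x - x ^ 3 / 6 + x ^ 5 / 120 - x ^ 7 / 5040 ≤ Real.sin x := by
  have := nonneg_of_hasDerivAt_nonneg
    (f := fun x => Real.sin x - (x - x ^ 3 / 6 + x ^ 5 / 120 - x ^ 7 / 5040))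
    (f' := fun x => Real.cos x - (1 - x ^ 2 / 2 + x ^ 4 / 24 - x ^ 6 / 720)) (fun x => by
      refine HasDerivAt.congr_deriv ((Real.hasDerivAt_sin x).sub ((((hasDerivAt_id x).sub
        ((hasDerivAt_pow 3 x).div_const 6)).add
        ((hasDerivAt_pow 5 x).div_const 120)).sub ((hasDerivAt_pow 7 x).div_const 5040))) ?_
      norm_num
      try ring) (by simp) (fun x hx => sub_nonneg.2 (sextic_le_cos hx)) hx
  linarith

/-- Power sums over `1, …, k`. -/
noncomputable def powSum (p k : ℕ) : ℝ := ∑ i ∈ Finset.range k, ((i : ℝ) + 1) ^ p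

theorem powSum_two (k : ℕ) : powSum 2 k = k * (k + 1) * (2 * k + 1) / 6 := by
  induction k with
  | zero => simp [powSum]
  | succ k ih => rw [powSum, Finset.sum_range_succ, ← powSum, ih]; push_cast; ring

theorem powSum_three (k : ℕ) : powSum 3 k = ((k : ℝ) * (k + 1)) ^ 2 / 4 := by
  induction k with
  | zero => simp [powSum]
  | succ k ih => rw [powSum, Finset.sum_range_succ, ← powSum, ih]; push_cast; ring

theorem powSum_four (k : ℕ) :
    powSum 4 k = (k : ℝ) * (k + 1) * (2 * k + 1) * (3 * (k * (k + 1)) - 1) / 30 := by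
  induction k with
  | zero => simp [powSum]
  | succ k ih => rw [powSum, Finset.sum_range_succ, ← powSum, ih]; push_cast; ring

theorem powSum_five (k : ℕ) :
    powSum 5 k = ((k : ℝ) * (k + 1)) ^ 2 * (2 * (k * (k + 1)) - 1) / 12 := by
  induction k with
  | zero => simp [powSum]
  | succ k ih => rw [powSum, Finset.sum_range_succ, ← powSum, ih]; push_cast; ring

theorem powSum_six (k : ℕ) : powSum 6 k =
    (k : ℝ) * (k + 1) * (2 * k + 1) * (3 * (k * (k + 1)) ^ 2 - 3 * (k * (k + 1)) + 1) / 42 := by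
  induction k with
  | zero => simp [powSum]
  | succ k ih => rw [powSum, Finset.sum_range_succ, ← powSum, ih]; push_cast; ring

theorem powSum_seven (k : ℕ) : powSum 7 k =
    ((k : ℝ) * (k + 1)) ^ 2 * (3 * (k * (k + 1)) ^ 2 - 4 * (k * (k + 1)) + 2) / 24 := by
  induction k with
  | zero => simp [powSum]
  | succ k ih => rw [powSum, Finset.sum_range_succ, ← powSum, ih]; push_cast; ring

/-- The derivative of `cosDefect`. -/
noncomputable def cosDefectDeriv (k : ℕ) (t : ℝ) : ℝ :=
  ∑ i ∈ Finset.range k, (i + 1) * Real.sin ((i + 1) * t)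

theorem hasDerivAt_cosDefect (k : ℕ) (t : ℝ) :
    HasDerivAt (cosDefect k) (cosDefectDeriv k t) t := by
  unfold cosDefect cosDefectDeriv
  refine HasDerivAt.fun_sum fun i _ => ?_
  have h := (((hasDerivAt_id t).const_mul ((i : ℝ) + 1)).cos).const_sub 1
  refine h.congr_deriv ?_
  simp only [id]
  ring

theorem continuous_cosDefect (k : ℕ) : Continuous (cosDefect k) := by
  unfold cosDefect; fun_prop

theorem continuous_cosDefectDeriv (k : ℕ) : Continuous (cosDefectDeriv k) := by
  unfold cosDefectDeriv; fun_prop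

theorem continuous_sinDefect (k : ℕ) : Continuous (sinDefect k) := by
  unfold sinDefect; fun_prop

theorem cosDefect_le (k : ℕ) (t : ℝ) : cosDefect k t ≤ powSum 2 k * t ^ 2 / 2 := by
  rw [cosDefect, powSum, Finset.sum_mul, Finset.sum_div]
  refine Finset.sum_le_sum fun i _ => ?_
  have := Real.one_sub_sq_div_two_le_cos (x := (i + 1) * t)
  rw [mul_pow] at this
  linarith

theorem cosDefect_nonneg (k : ℕ) (t : ℝ) : 0 ≤ cosDefect k t :=
  Finset.sum_nonneg fun _ _ => sub_nonneg.2 (Real.cos_le_one _)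

section
variable (k : ℕ) {t : ℝ} (ht : 0 ≤ t)
include ht

theorem mul_cosDefectDeriv_le : t * cosDefectDeriv k t ≤ powSum 2 k * t ^ 2 := by
  rw [cosDefectDeriv, powSum, Finset.sum_mul, Finset.mul_sum]
  refine Finset.sum_le_sum fun i _ => ?_
  have hx : 0 ≤ ((i : ℝ) + 1) * t := by positivity
  have := mul_le_mul_of_nonneg_left (Real.sin_le hx) hx
  linarith

theorem le_mul_cosDefectDeriv :
    powSum 2 k * t ^ 2 - powSum 4 k * t ^ 4 / 6 ≤ t * cosDefectDeriv k t := by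
  rw [cosDefectDeriv, powSum, powSum, Finset.sum_mul, Finset.sum_mul, Finset.sum_div,
    ← Finset.sum_sub_distrib, Finset.mul_sum]
  refine Finset.sum_le_sum fun i _ => ?_
  have hx : 0 ≤ ((i : ℝ) + 1) * t := by positivity
  have := mul_le_mul_of_nonneg_left (sub_cube_le_sin hx) hx
  linarith

theorem mul_cosDefectDeriv_le_sextic : t * cosDefectDeriv k t ≤
    powSum 2 k * t ^ 2 - powSum 4 k * t ^ 4 / 6 + powSum 6 k * t ^ 6 / 120 := by
  rw [cosDefectDeriv, powSum, powSum, powSum, Finset.sum_mul, Finset.sum_mul, Finset.sum_mul,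
    Finset.sum_div, Finset.sum_div, ← Finset.sum_sub_distrib, ← Finset.sum_add_distrib,
    Finset.mul_sum]
  refine Finset.sum_le_sum fun i _ => ?_
  have hx : 0 ≤ ((i : ℝ) + 1) * t := by positivity
  have := mul_le_mul_of_nonneg_left (sin_le_quintic hx) hx
  linarith

theorem sinDefect_nonneg : 0 ≤ sinDefect k t :=
  Finset.sum_nonneg fun i _ => sub_nonneg.2 (Real.sin_le (by positivity))

theorem sinDefect_le : sinDefect k t ≤ powSum 3 k * t ^ 3 / 6 := by
  rw [sinDefect, powSum, Finset.sum_mul, Finset.sum_div]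
  refine Finset.sum_le_sum fun i _ => ?_
  have := sub_cube_le_sin (show 0 ≤ ((i : ℝ) + 1) * t by positivity)
  linarith

theorem le_sinDefect :
    powSum 3 k * t ^ 3 / 6 - powSum 5 k * t ^ 5 / 120 ≤ sinDefect k t := by
  rw [sinDefect, powSum, powSum, Finset.sum_mul, Finset.sum_mul, Finset.sum_div, Finset.sum_div,
    ← Finset.sum_sub_distrib]
  refine Finset.sum_le_sum fun i _ => ?_
  have := sin_le_quintic (show 0 ≤ ((i : ℝ) + 1) * t by positivity)
  linarith

theorem sinDefect_le_septic : sinDefect k t ≤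
    powSum 3 k * t ^ 3 / 6 - powSum 5 k * t ^ 5 / 120 + powSum 7 k * t ^ 7 / 5040 := by
  rw [sinDefect, powSum, powSum, powSum, Finset.sum_mul, Finset.sum_mul, Finset.sum_mul,
    Finset.sum_div, Finset.sum_div, Finset.sum_div, ← Finset.sum_sub_distrib,
    ← Finset.sum_add_distrib]
  refine Finset.sum_le_sum fun i _ => ?_
  have := septic_le_sin (show 0 ≤ ((i : ℝ) + 1) * t by positivity)
  linarith

end

theorem two_mul_sin_mul_cosDefect (k : ℕ) (t : ℝ) :
    2 * Real.sin (t / 2) * cosDefect k t =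
      (2 * k + 1) * Real.sin (t / 2) - Real.sin ((2 * k + 1) * t / 2) := by
  have h := one_add_two_mul_sum_cos_mul_sin k t
  rw [cosDefect, Finset.sum_sub_distrib]
  rw [show ((k : ℝ) + 1 / 2) * t = (2 * k + 1) * t / 2 by ring] at h
  rw [← h]
  simp
  ring

/-- Moments of `v t²` on `[0, T]` against the weight `exp (-G)`. -/
noncomputable def gaussMoment (G : ℝ → ℝ) (v T : ℝ) (j : ℕ) : ℝ :=
  ∫ t in (0 : ℝ)..T, Real.exp (-G t) * (v * t ^ 2) ^ j

section
variable {G G' : ℝ → ℝ} {v T ρ : ℝ}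

theorem integral_exp_neg_mul_sum (hG : Continuous G) {N : ℕ} (a : Fin N → ℝ) :
    ∫ t in (0 : ℝ)..T, Real.exp (-G t) * ∑ i, a i * (v * t ^ 2) ^ (i : ℕ) =
      ∑ i, a i * gaussMoment G v T i := by
  simp only [Finset.mul_sum, gaussMoment, ← intervalIntegral.integral_const_mul]
  rw [intervalIntegral.integral_finsetSum fun i _ => Continuous.intervalIntegrable (by fun_prop) _ _]
  refine Finset.sum_congr rfl fun i _ => ?_
  congr 1
  funext t
  ring

theorem integral_by_parts_gaussMoment (hG : ∀ t, HasDerivAt G (G' t) t) (hG' : Continuous G')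
    (j : ℕ) :
    ∫ t in (0 : ℝ)..T, Real.exp (-G t) * ((v * t ^ 2) ^ j * (t * G' t)) =
      (2 * j + 1) * gaussMoment G v T j - T * (v * T ^ 2) ^ j * Real.exp (-G T) := by
  have hGc : Continuous G := continuous_iff_continuousAt.2 fun t => (hG t).continuousAt
  have hd : ∀ t, HasDerivAt (fun t => t * (v * t ^ 2) ^ j * Real.exp (-G t))
      ((2 * j + 1) * (Real.exp (-G t) * (v * t ^ 2) ^ j) -
        Real.exp (-G t) * ((v * t ^ 2) ^ j * (t * G' t))) t := by
    intro t
    have e : (fun t : ℝ => t * (v * t ^ 2) ^ j * Real.exp (-G t)) =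
        fun t => v ^ j * t ^ (2 * j + 1) * Real.exp (-G t) := by
      funext t
      rw [mul_pow, ← pow_mul]
      ring
    have h1 := ((hasDerivAt_pow (2 * j + 1) t).const_mul (v ^ j)).mul (hG t).neg.exp
    rw [e]
    refine h1.congr_deriv ?_
    rw [mul_pow, ← pow_mul, Nat.add_sub_cancel, Pi.neg_apply]
    push_cast
    ring
  have h := intervalIntegral.integral_eq_sub_of_hasDerivAt (a := 0) (b := T) (fun t _ => hd t)
    (Continuous.intervalIntegrable (by fun_prop) _ _)
  rw [intervalIntegral.integral_sub (Continuous.intervalIntegrable (by fun_prop) _ _)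
    (Continuous.intervalIntegrable (by fun_prop) _ _), intervalIntegral.integral_const_mul] at h
  rw [gaussMoment]
  linarith

theorem gaussMoment_nonneg (hT : 0 ≤ T) (hv : 0 ≤ v) (j : ℕ) : 0 ≤ gaussMoment G v T j :=
  intervalIntegral.integral_nonneg hT fun t _ => by positivity

theorem integral_exp_neg_mul_mono (hG : Continuous G) {f g : ℝ → ℝ} (hf : Continuous f)
    (hg : Continuous g) (hT : 0 ≤ T) (h : ∀ t ∈ Set.Icc 0 T, f t ≤ g t) :
    ∫ t in (0 : ℝ)..T, Real.exp (-G t) * f t ≤ ∫ t in (0 : ℝ)..T, Real.exp (-G t) * g t :=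
  intervalIntegral.integral_mono_on hT (Continuous.intervalIntegrable (by fun_prop) _ _)
    (Continuous.intervalIntegrable (by fun_prop) _ _)
    fun t ht => mul_le_mul_of_nonneg_left (h t ht) (Real.exp_pos _).le

theorem mul_gaussMoment_succ_le (hG : Continuous G) (hT : 0 ≤ T) (hv : 0 ≤ v) (hρ : 0 ≤ ρ)
    (hρT : ρ * (v * T ^ 2) ≤ 4) (j : ℕ) :
    ρ * gaussMoment G v T (j + 1) ≤ 4 * gaussMoment G v T j := by
  have h := integral_exp_neg_mul_mono (G := G) (f := fun t => ρ * (v * t ^ 2) ^ (j + 1))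
    (g := fun t => 4 * (v * t ^ 2) ^ j) hG (by fun_prop) (by fun_prop) hT fun t ht => by
      rw [pow_succ, mul_comm ((v * t ^ 2) ^ j), ← mul_assoc]
      refine mul_le_mul_of_nonneg_right (le_trans ?_ hρT) (by positivity)
      have := ht.1
      have := ht.2
      gcongr
  simp only [mul_left_comm (Real.exp _), intervalIntegral.integral_const_mul] at h
  exact h

theorem gaussMoment_succ_le (hG : ∀ t, HasDerivAt G (G' t) t) (hG' : Continuous G')
    (hT : 0 ≤ T) (hv : 0 ≤ v)
    (h : ∀ t ∈ Set.Icc 0 T, v * t ^ 2 - ρ / 10 * (v * t ^ 2) ^ 2 ≤ t * G' t) (j : ℕ) :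
    gaussMoment G v T (j + 1) ≤
      (2 * j + 1) * gaussMoment G v T j + ρ / 10 * gaussMoment G v T (j + 2) := by
  have hGc : Continuous G := continuous_iff_continuousAt.2 fun t => (hG t).continuousAt
  have h1 := integral_exp_neg_mul_mono (G := G)
    (f := fun t => (v * t ^ 2) ^ j * (v * t ^ 2 - ρ / 10 * (v * t ^ 2) ^ 2))
    (g := fun t => (v * t ^ 2) ^ j * (t * G' t)) hGc (by fun_prop) (by fun_prop) hT fun t ht =>
      mul_le_mul_of_nonneg_left (h t ht) (by positivity)
  rw [integral_by_parts_gaussMoment hG hG'] at h1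
  have h2 : 0 ≤ T * (v * T ^ 2) ^ j * Real.exp (-G T) := by positivity
  have h3 : ∫ t in (0 : ℝ)..T, Real.exp (-G t) *
      ((v * t ^ 2) ^ j * (v * t ^ 2 - ρ / 10 * (v * t ^ 2) ^ 2)) =
      gaussMoment G v T (j + 1) - ρ / 10 * gaussMoment G v T (j + 2) := by
    simp only [gaussMoment]
    rw [← intervalIntegral.integral_const_mul, ← intervalIntegral.integral_sub
      (Continuous.intervalIntegrable (by fun_prop) _ _)
      (Continuous.intervalIntegrable (by fun_prop) _ _)]
    congr 1
    funext t
    ring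
  linarith

theorem le_gaussMoment_succ (hG : ∀ t, HasDerivAt G (G' t) t) (hG' : Continuous G')
    (hT : 0 ≤ T) (hv : 0 ≤ v) (h : ∀ t ∈ Set.Icc 0 T, t * G' t ≤ v * t ^ 2) (j : ℕ) :
    (2 * j + 1) * gaussMoment G v T j - T * (v * T ^ 2) ^ j * Real.exp (-G T) ≤
      gaussMoment G v T (j + 1) := by
  have hGc : Continuous G := continuous_iff_continuousAt.2 fun t => (hG t).continuousAt
  have h1 := integral_exp_neg_mul_mono (G := G)
    (f := fun t => (v * t ^ 2) ^ j * (t * G' t))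
    (g := fun t => (v * t ^ 2) ^ (j + 1)) hGc (by fun_prop) (by fun_prop) hT fun t ht => by
      rw [pow_succ]
      exact mul_le_mul_of_nonneg_left (h t ht) (pow_nonneg (mul_nonneg hv (sq_nonneg t)) j)
  rw [integral_by_parts_gaussMoment hG hG'] at h1
  exact h1

theorem le_gaussMoment_one {σ τ : ℝ} (hG : ∀ t, HasDerivAt G (G' t) t) (hG' : Continuous G')
    (hT : 0 ≤ T)
    (h : ∀ t ∈ Set.Icc 0 T,
      t * G' t ≤ v * t ^ 2 - σ * (v * t ^ 2) ^ 2 + τ * (v * t ^ 2) ^ 3) :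
    gaussMoment G v T 0 - T * Real.exp (-G T) + σ * gaussMoment G v T 2 -
      τ * gaussMoment G v T 3 ≤ gaussMoment G v T 1 := by
  have hGc : Continuous G := continuous_iff_continuousAt.2 fun t => (hG t).continuousAt
  have h1 := integral_exp_neg_mul_mono (G := G)
    (f := fun t => (v * t ^ 2) ^ 0 * (t * G' t))
    (g := fun t => ∑ i, (![0, 1, -σ, τ] : Fin 4 → ℝ) i * (v * t ^ 2) ^ (i : ℕ))
    hGc (by fun_prop) (by fun_prop) hT fun t ht => by
      have := h t ht
      simp [Fin.sum_univ_succ, Fin.succ] at this ⊢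
      linarith
  rw [integral_by_parts_gaussMoment hG hG', integral_exp_neg_mul_sum hGc] at h1
  simp [Fin.sum_univ_succ, Fin.succ] at h1
  linarith

theorem gaussMoment_le (hG : ∀ t, HasDerivAt G (G' t) t) (hG' : Continuous G')
    (hT : 0 ≤ T) (hv : 0 ≤ v) (hρ : 0 ≤ ρ) (hρ1 : ρ ≤ 1 / 10) (hρT : ρ * (v * T ^ 2) ≤ 4)
    (h : ∀ t ∈ Set.Icc 0 T, v * t ^ 2 - ρ / 10 * (v * t ^ 2) ^ 2 ≤ t * G' t) :
    gaussMoment G v T 1 ≤ 1.033 * gaussMoment G v T 0 ∧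
    gaussMoment G v T 2 ≤ 3.28 * gaussMoment G v T 0 ∧
    gaussMoment G v T 3 ≤ 17.8 * gaussMoment G v T 0 ∧
    gaussMoment G v T 4 ≤ 139 * gaussMoment G v T 0 ∧
    gaussMoment G v T 5 ≤ 1442 * gaussMoment G v T 0 ∧
    gaussMoment G v T 6 ≤ 19000 * gaussMoment G v T 0 ∧
    gaussMoment G v T 7 ≤ 16.45 * gaussMoment G v T 6 := by
  have hGc : Continuous G := continuous_iff_continuousAt.2 fun t => (hG t).continuousAt
  have hE := gaussMoment_nonneg (G := G) hT hv
  have hU := gaussMoment_succ_le hG hG' hT hv h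
  have h10 : ∀ j, ρ / 10 * gaussMoment G v T j ≤ 0.01 * gaussMoment G v T j := fun j =>
    mul_le_mul_of_nonneg_right (by linarith) (hE j)
  have hC := mul_gaussMoment_succ_le hGc hT hv hρ hρT 9
  have h0 := hU 0
  have h1 := hU 1
  have h2 := hU 2
  have h3 := hU 3
  have h4 := hU 4
  have h5 := hU 5
  have h6 := hU 6
  have h7 := hU 7
  have h8 := hU 8
  norm_num at h0 h1 h2 h3 h4 h5 h6 h7 h8 hC
  have g9 : gaussMoment G v T 9 ≤ 28.4 * gaussMoment G v T 8 := by
    linarith [hE 8]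
  have g8 : gaussMoment G v T 8 ≤ 20.95 * gaussMoment G v T 7 := by linarith [h10 9, hE 7]
  have g7 : gaussMoment G v T 7 ≤ 16.45 * gaussMoment G v T 6 := by linarith [h10 8, hE 6]
  have g6 : gaussMoment G v T 6 ≤ 13.17 * gaussMoment G v T 5 := by linarith [h10 7, hE 5]
  have g5 : gaussMoment G v T 5 ≤ 10.37 * gaussMoment G v T 4 := by linarith [h10 6, hE 4]
  have g4 : gaussMoment G v T 4 ≤ 7.81 * gaussMoment G v T 3 := by linarith [h10 5, hE 3]
  have g3 : gaussMoment G v T 3 ≤ 5.424 * gaussMoment G v T 2 := by linarith [h10 4, hE 2]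
  have g2 : gaussMoment G v T 2 ≤ 3.173 * gaussMoment G v T 1 := by linarith [h10 3, hE 1]
  have g1 : gaussMoment G v T 1 ≤ 1.033 * gaussMoment G v T 0 := by linarith [h10 2, hE 0]
  have := hE 0
  refine ⟨g1, ?_, ?_, ?_, ?_, ?_, ?_⟩ <;> linarith

end

section
variable {E e1 e2 e3 e4 e5 e6 e7 ρ g μ ε : ℝ}

theorem moment_combination_pos (hρ : 0 ≤ ρ) (hρ1 : ρ ≤ 1 / 10) (hg : 0 ≤ g) (hg1 : g ≤ 1 / 2)
    (hμ : 0 ≤ μ) (hμ1 : μ * (384 + 96 * g) = 1) (hε : ρ * (1 / 6 + g) ≤ ε) (hε1 : ε ≤ 6)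
    (hE : 0 ≤ E) (h4 : 0 ≤ e4)
    (u0 : e1 ≤ E + ρ / 10 * e2) (u1 : e2 ≤ 3 * e1 + ρ / 10 * e3)
    (c1 : e1 ≤ 1.033 * E) (c2 : e2 ≤ 3.28 * E) (c3 : e3 ≤ 17.8 * E)
    (c5 : e5 ≤ 1442 * E) (c6 : e6 ≤ 19000 * E) (c7 : e7 ≤ 16.45 * e6)
    (hl : e1 - 3 * e2 + 3 * e3 - e4 ≤ -68 * E + 6 * ρ * E) :
    0.02 * ρ * E ≤ (1 + ε) * E - e1 + ρ / 30 * (1 - g / 2) * e2 - ρ ^ 2 / 1680 * e3 -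
      ρ * μ * (e1 - 3 * e2 + 3 * e3 - e4 + ρ / 10 * (e3 - 2 * e4 + e5) + ρ ^ 2 / 300 * e5 +
        (3 * ε + 3 * ε ^ 2 + ε ^ 3) * e1 + 3 * ε * e3) -
      3 / 10 * (ρ * μ) ^ 2 * (e3 - 4 * e4 + 6 * e5 - 4 * e6 + e7) -
      g * ρ / 22 * ((1 + ε) * e1 + e2) := by
  have hε0 : 0 ≤ ε := le_trans (by positivity) hε
  have hμ2 : μ ≤ 1 / 384 := by linarith only [hμ1, mul_nonneg hμ hg, hμ]
  have hμ3 : (1 - g / 4) / 384 ≤ μ := by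
    linarith only [hμ1, mul_le_mul_of_nonneg_right hμ2 hg]
  have hρE : 0 ≤ ρ * E := by positivity
  have hgρE : 0 ≤ g * ρ * E := by positivity
  have hρ2E : ρ ^ 2 * E ≤ 1 / 10 * (ρ * E) := by
    linarith only [mul_le_mul_of_nonneg_right hρ1 hρE]
  have hρ2E0 : 0 ≤ ρ ^ 2 * E := by positivity
  have hρμ : ρ * μ ≤ ρ / 384 := by linarith only [mul_le_mul_of_nonneg_left hμ2 hρ]
  have hρμ0 : 0 ≤ ρ * μ := by positivity
  -- first-order part
  have hA : ε * E - ρ / 5 * E - 0.0185 * (ρ * E) - 0.055 * (g * ρ * E) ≤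
      (1 + ε) * E - e1 + ρ / 30 * (1 - g / 2) * e2 := by
    have a1 := mul_le_mul_of_nonneg_left u0 hρ
    have a2 := mul_le_mul_of_nonneg_left u1 hρ
    have a3 := mul_le_mul_of_nonneg_left c2 (sq_nonneg ρ)
    have a4 := mul_le_mul_of_nonneg_left c3 (sq_nonneg ρ)
    have a5 := mul_le_mul_of_nonneg_left c2 (mul_nonneg hg hρ)
    linarith only [a1, a2, a3, a4, a5, hρ2E, u0, hρE, hgρE]
  have hA' : ρ ^ 2 / 1680 * e3 ≤ 0.0011 * (ρ * E) := by
    have a4 := mul_le_mul_of_nonneg_left c3 (sq_nonneg ρ)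
    linarith only [a4, hρ2E, hρE]
  -- cubic part
  have hB : ρ * μ * (e1 - 3 * e2 + 3 * e3 - e4) ≤
      -(0.177 * (ρ * E)) + 0.0443 * (g * ρ * E) + 0.0016 * (ρ * E) := by
    have a1 := mul_le_mul_of_nonneg_left hl hρμ0
    have a2 := mul_le_mul_of_nonneg_right hμ3 hρE
    have a3 := mul_le_mul_of_nonneg_right hμ2 (mul_nonneg hρ hρE)
    linarith only [a1, a2, a3, hρ2E, hρE, hgρE]
  have hC : ρ * μ * (ρ / 10 * (e3 - 2 * e4 + e5) + ρ ^ 2 / 300 * e5) ≤ 0.0385 * (ρ * E) := by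
    have a1 : ρ / 10 * (e3 - 2 * e4 + e5) + ρ ^ 2 / 300 * e5 ≤ 146.6 * (ρ * E) := by
      have b1 : ρ / 10 * (e3 - 2 * e4 + e5) ≤ ρ / 10 * (1459.8 * E) :=
        mul_le_mul_of_nonneg_left (by linarith only [c3, c5, h4]) (by positivity)
      have b2 := mul_le_mul_of_nonneg_left c5 (sq_nonneg ρ)
      linarith only [b1, b2, hρ2E, hρE]
    have a2 := mul_le_mul_of_nonneg_left a1 hρμ0
    have a3 := mul_le_mul_of_nonneg_right hρμ hρE
    linarith only [a2, a3, hρ2E, hρE]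
  have hD : ρ * μ * ((3 * ε + 3 * ε ^ 2 + ε ^ 3) * e1 + 3 * ε * e3) ≤ 0.0293 * (ε * E) := by
    have hεE : 0 ≤ ε * E := by positivity
    have a1 : (3 * ε + 3 * ε ^ 2 + ε ^ 3) * e1 + 3 * ε * e3 ≤ 112.3 * (ε * E) := by
      have b0 : 3 * ε + 3 * ε ^ 2 + ε ^ 3 ≤ 57 * ε := by
        have d1 := mul_le_mul_of_nonneg_left hε1 hε0
        have d2 := mul_le_mul_of_nonneg_left d1 hε0
        linarith only [d1, d2, hε0]
      have b1 := mul_le_mul_of_nonneg_left c1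
        (show 0 ≤ 3 * ε + 3 * ε ^ 2 + ε ^ 3 by positivity)
      have b2 := mul_le_mul_of_nonneg_right b0 hE
      have b3 := mul_le_mul_of_nonneg_left c3 hε0
      linarith only [b1, b2, b3, hεE]
    have a2 := mul_le_mul_of_nonneg_left a1 hρμ0
    have a3 : ρ * μ ≤ 1 / 3840 := by linarith only [hρμ, hρ1]
    have a4 := mul_le_mul_of_nonneg_right a3 hεE
    linarith only [a2, a4, hεE]
  have hF : 3 / 10 * (ρ * μ) ^ 2 * (e3 - 4 * e4 + 6 * e5 - 4 * e6 + e7) ≤ 0.05 * (ρ * E) := by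
    have a1 : e3 - 4 * e4 + 6 * e5 - 4 * e6 + e7 ≤ 245300 * E := by
      linarith only [c3, h4, c5, c6, c7, hE]
    have a2 : (ρ * μ) ^ 2 ≤ ρ ^ 2 / 147456 := by
      have := pow_le_pow_left₀ hρμ0 hρμ 2
      linarith only [this]
    have a3 := mul_le_mul_of_nonneg_left a1 (show 0 ≤ 3 / 10 * (ρ * μ) ^ 2 by positivity)
    have a4 := mul_le_mul_of_nonneg_right a2 hE
    linarith only [a3, a4, hρ2E, hρ2E0]
  have hH : g * ρ / 22 * ((1 + ε) * e1 + e2) ≤ 0.2 * (g * ρ * E) + 0.0024 * (ε * E) := by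
    have a1 : (1 + ε) * e1 ≤ (1 + ε) * (1.033 * E) :=
      mul_le_mul_of_nonneg_left c1 (by positivity)
    have a2 : g * ρ / 22 * ((1 + ε) * e1 + e2) ≤
        g * ρ / 22 * ((1 + ε) * (1.033 * E) + 3.28 * E) :=
      mul_le_mul_of_nonneg_left (by linarith only [a1, c2]) (by positivity)
    have a3 : g * ρ * (ε * E) ≤ 1 / 20 * (ε * E) :=
      mul_le_mul_of_nonneg_right
        (by linarith only [mul_le_mul_of_nonneg_right hg1 hρ, hρ1]) (by positivity)
    linarith only [a2, a3, hgρE, mul_nonneg hε0 hE]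
  have hεE := mul_le_mul_of_nonneg_right hε hE
  linarith only [hεE, hA, hA', hB, hC, hD, hF, hH, hρE, hgρE]

theorem moment_combination_neg {b0 b1 : ℝ} (hρ : 0 ≤ ρ) (hρ1 : ρ ≤ 1 / 10) (hg : 0 ≤ g)
    (hg1 : g ≤ 1 / 2)
    (hμ : 0 ≤ μ) (hμ1 : μ * (384 + 96 * g) = 1) (hε : ρ * (1 / 8 + g) ≤ ε) (hε1 : ε ≤ 6)
    (hE : 0 ≤ E) (h1 : 0 ≤ e1) (h2 : 0 ≤ e2)
    (u0 : e1 ≤ E + ρ / 10 * e2) (u1 : e2 ≤ 3 * e1 + ρ / 10 * e3)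
    (u2 : e3 ≤ 5 * e2 + ρ / 10 * e4) (u3 : e4 ≤ 7 * e3 + ρ / 10 * e5)
    (l0 : E - b0 + ρ / 10 * (1 - g / 3) * e2 - ρ ^ 2 / 280 * e3 ≤ e1)
    (l1 : 3 * E - b1 ≤ e2) (hb0 : b0 ≤ 0.001 * (ρ * E)) (hb1 : b1 ≤ 0.001 * E)
    (c1 : e1 ≤ 1.033 * E) (c2 : e2 ≤ 3.28 * E) (c3 : e3 ≤ 17.8 * E) (c4 : e4 ≤ 139 * E)
    (c5 : e5 ≤ 1442 * E) :
    (1 - ε) * E - e1 + ρ / 30 * e2 -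
      ρ * μ * ((1 - ε) ^ 3 * e1 - 3 * (1 - ε) ^ 2 * e2 + 3 * (1 - ε) * e3 - e4) +
      3 / 10 * (ρ * μ) ^ 2 * e2 + g * ρ / 22 * ((1 + ε) * e1 + e2) ≤ -(0.02 * ρ * E) := by
  have hε0 : 0 ≤ ε := le_trans (by positivity) hε
  have hμ2 : μ ≤ 1 / 384 := by linarith only [hμ1, mul_nonneg hμ hg, hμ]
  have hρE : 0 ≤ ρ * E := by positivity
  have hgρE : 0 ≤ g * ρ * E := by positivity
  have hρ2E : ρ ^ 2 * E ≤ 1 / 10 * (ρ * E) := by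
    linarith only [mul_le_mul_of_nonneg_right hρ1 hρE]
  have hρ2E0 : 0 ≤ ρ ^ 2 * E := by positivity
  have hρμ : ρ * μ ≤ ρ / 384 := by linarith only [mul_le_mul_of_nonneg_left hμ2 hρ]
  have hρμ0 : 0 ≤ ρ * μ := by positivity
  have hεE : 0 ≤ ε * E := by positivity
  have a3 := mul_le_mul_of_nonneg_left c3 (sq_nonneg ρ)
  have hA : (1 - ε) * E - e1 + ρ / 30 * e2 ≤
      -(ε * E) - ρ / 5 * E + 0.008 * (ρ * E) + 0.11 * (g * ρ * E) := by
    have a1 := mul_le_mul_of_nonneg_left l1 hρ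
    have a2 := mul_le_mul_of_nonneg_left c2 (mul_nonneg hg hρ)
    have a4 := mul_le_mul_of_nonneg_left hb1 hρ
    linarith only [a1, a2, a3, a4, l0, hb0, hρ2E, hρE, hgρE]
  have hB : ρ * μ * (-e1 + 3 * e2 - 3 * e3 + e4) ≤ 0.246 * (ρ * E) := by
    have d2 := mul_le_mul_of_nonneg_left c2 hρ
    have d3 := mul_le_mul_of_nonneg_left c3 hρ
    have d4 := mul_le_mul_of_nonneg_left c4 hρ
    have d5 := mul_le_mul_of_nonneg_left c5 hρ
    have a1 : -e1 + 3 * e2 - 3 * e3 + e4 ≤ 68 * E + 263.1 * (ρ * E) := by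
      linarith only [d2, d3, d4, d5, u0, u1, u2, u3, hρE]
    have a2 := mul_le_mul_of_nonneg_left a1 hρμ0
    have a3 : ρ * μ * (68 * E + 263.1 * (ρ * E)) ≤ ρ / 384 * (68 * E + 263.1 * (ρ * E)) :=
      mul_le_mul_of_nonneg_right hρμ (by positivity)
    linarith only [a2, a3, hρ2E, hρE]
  have hC : ρ * μ * ((3 + ε ^ 2) * e1 + 3 * ε * e2 + 3 * e3) * ε ≤ 0.04 * (ε * E) := by
    have a1 : (3 + ε ^ 2) * e1 + 3 * ε * e2 + 3 * e3 ≤ 153 * E := by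
      have b1 : (3 + ε ^ 2) * e1 ≤ 39 * (1.033 * E) :=
        mul_le_mul (by nlinarith only [hε0, hε1]) c1 h1 (by norm_num)
      have b2 : ε * e2 ≤ 6 * (3.28 * E) := mul_le_mul hε1 c2 h2 (by norm_num)
      linarith only [b1, b2, c3, hE]
    have a2 := mul_le_mul_of_nonneg_left a1 hρμ0
    have a3 : ρ * μ * (153 * E) ≤ 1 / 3840 * (153 * E) :=
      mul_le_mul_of_nonneg_right (by linarith only [hρμ, hρ1]) (by positivity)
    have a4 : ρ * μ * ((3 + ε ^ 2) * e1 + 3 * ε * e2 + 3 * e3) ≤ 0.04 * E := by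
      linarith only [a2, a3, hE]
    have := mul_le_mul_of_nonneg_right a4 hε0
    linarith only [this]
  have hC' : 0 ≤ ρ * μ * ε * (3 * ε * e1 + 6 * e2) := by positivity
  have hF : 3 / 10 * (ρ * μ) ^ 2 * e2 ≤ 0.001 * (ρ * E) := by
    have a2 : (ρ * μ) ^ 2 ≤ ρ ^ 2 / 147456 := by
      have := pow_le_pow_left₀ hρμ0 hρμ 2
      linarith only [this]
    have a3 := mul_le_mul_of_nonneg_left c2 (show 0 ≤ 3 / 10 * (ρ * μ) ^ 2 by positivity)
    have a4 := mul_le_mul_of_nonneg_right a2 hE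
    linarith only [a3, a4, hρ2E, hρ2E0]
  have hH : g * ρ / 22 * ((1 + ε) * e1 + e2) ≤ 0.2 * (g * ρ * E) + 0.0024 * (ε * E) := by
    have a1 : (1 + ε) * e1 ≤ (1 + ε) * (1.033 * E) :=
      mul_le_mul_of_nonneg_left c1 (by positivity)
    have a2 : g * ρ / 22 * ((1 + ε) * e1 + e2) ≤
        g * ρ / 22 * ((1 + ε) * (1.033 * E) + 3.28 * E) :=
      mul_le_mul_of_nonneg_left (by linarith only [a1, c2]) (by positivity)
    have a3 : g * ρ * (ε * E) ≤ 1 / 20 * (ε * E) :=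
      mul_le_mul_of_nonneg_right
        (by linarith only [mul_le_mul_of_nonneg_right hg1 hρ, hρ1]) (by positivity)
    linarith only [a2, a3, hgρE, mul_nonneg hε0 hE]
  have hεE' := mul_le_mul_of_nonneg_right hε hE
  have key : ρ * μ * ((1 - ε) ^ 3 * e1 - 3 * (1 - ε) ^ 2 * e2 + 3 * (1 - ε) * e3 - e4) =
      -(ρ * μ * (-e1 + 3 * e2 - 3 * e3 + e4)) -
        ρ * μ * ((3 + ε ^ 2) * e1 + 3 * ε * e2 + 3 * e3) * ε +
        ρ * μ * ε * (3 * ε * e1 + 6 * e2) := by ring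
  rw [key]
  linarith only [hεE', hA, hB, hC, hC', hF, hH, hρE, hgρE]

end

theorem mul_le_sin_mul {z w B : ℝ} (hz : 0 ≤ z) (hB : 0 ≤ B) (hw : w ≤ 0 → (-w) ^ 5 ≤ B) :
    z * (w - z ^ 2 * w ^ 3 / 6 - z ^ 4 * B / 120) ≤ Real.sin (z * w) := by
  have h0 : 0 ≤ z * (z ^ 4 * B / 120) := by positivity
  rcases le_total 0 w with h | h
  · have := sub_cube_le_sin (mul_nonneg hz h)
    linarith
  · have h1 := sin_le_quintic (mul_nonneg hz (neg_nonneg.2 h))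
    rw [mul_neg, Real.sin_neg] at h1
    have h2 := mul_le_mul_of_nonneg_left (hw h) (show 0 ≤ z ^ 5 / 120 by positivity)
    linarith

theorem sin_mul_le_mul {z w : ℝ} (hz : 0 ≤ z) (hw : w ≤ 1) :
    Real.sin (z * w) ≤ z * (w - z ^ 2 * w ^ 3 / 6 + z ^ 4 / 120) := by
  have h0 : 0 ≤ z ^ 5 / 120 := by positivity
  rcases le_total 0 w with h | h
  · have h1 := sin_le_quintic (mul_nonneg hz h)
    have h2 := mul_le_mul_of_nonneg_left (pow_le_one₀ (n := 5) h hw) h0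
    linarith
  · have h1 := sub_cube_le_sin (mul_nonneg hz (neg_nonneg.2 h))
    rw [mul_neg, Real.sin_neg] at h1
    linarith

theorem half_div_sin_half_mem {t : ℝ} (ht : 0 < t) (ht2 : t ^ 2 ≤ 2) :
    1 ≤ t / 2 / Real.sin (t / 2) ∧ t / 2 / Real.sin (t / 2) ≤ 1 + t ^ 2 / 22 := by
  have h1 := sub_cube_le_sin (show 0 ≤ t / 2 by positivity)
  have h2 := Real.sin_le (show 0 ≤ t / 2 by positivity)
  have h3 : 0 < Real.sin (t / 2) := by
    refine lt_of_lt_of_le ?_ h1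
    nlinarith
  refine ⟨(one_le_div h3).2 h2, (div_le_iff₀ h3).2 ?_⟩
  have h4 := mul_le_mul_of_nonneg_left h1 (show 0 ≤ 1 + t ^ 2 / 22 by positivity)
  have h5 : 0 ≤ t ^ 3 * (2 - t ^ 2) := mul_nonneg (by positivity) (by linarith)
  linarith

theorem mul_le_div_sin_half {t d N a B : ℝ} (ht : 0 < t) (ht2 : t ^ 2 ≤ 2)
    (hN : d * t * a ≤ N) (hB : |N| ≤ d * t * B) :
    2 * d * (a - t ^ 2 / 22 * B) ≤ N / Real.sin (t / 2) := by
  obtain ⟨h1, h2⟩ := half_div_sin_half_mem ht ht2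
  have e : N / Real.sin (t / 2) = 2 / t * (N * (t / 2 / Real.sin (t / 2))) := by
    field_simp
  have h3 : N - t ^ 2 / 22 * |N| ≤ N * (t / 2 / Real.sin (t / 2)) := by
    have a1 := mul_le_mul_of_nonneg_left (sub_le_iff_le_add'.2 h2) (abs_nonneg N)
    have a2 := mul_le_mul_of_nonneg_right (neg_abs_le N) (sub_nonneg.2 h1)
    linarith
  have h4 : d * t * (a - t ^ 2 / 22 * B) ≤ N * (t / 2 / Real.sin (t / 2)) := by
    have := mul_le_mul_of_nonneg_left hB (show 0 ≤ t ^ 2 / 22 by positivity)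
    linarith
  rw [e]
  refine le_trans (le_of_eq ?_) (mul_le_mul_of_nonneg_left h4 (show 0 ≤ 2 / t by positivity))
  field_simp

section
variable {t d y X ρ g μ ε : ℝ}

theorem poly_le_sin_div_sin (ht : 0 < t) (ht2 : t ^ 2 ≤ 2) (hd : 0 ≤ d) (hρ : 0 ≤ ρ) (hμ : 0 ≤ μ)
    (hy : 0 ≤ y) (hdy : (d * t) ^ 2 = 6 * (ρ * μ) * y) (hty : t ^ 2 = g * ρ * y) (hρy : ρ * y ≤ 4)
    (hε : 0 ≤ ε) (hX : 0 ≤ X) (hXy : X ≤ y) (hX1 : y - ρ / 30 * y ^ 2 ≤ X)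
    (hX2 : X ≤ y - ρ / 30 * (1 - g / 2) * y ^ 2 + ρ ^ 2 / 1680 * y ^ 3) :
    2 * d * ((1 + ε) - y + ρ / 30 * (1 - g / 2) * y ^ 2 - ρ ^ 2 / 1680 * y ^ 3 -
      ρ * μ * (y - 3 * y ^ 2 + 3 * y ^ 3 - y ^ 4 + ρ / 10 * (y ^ 3 - 2 * y ^ 4 + y ^ 5) +
        ρ ^ 2 / 300 * y ^ 5 + (3 * ε + 3 * ε ^ 2 + ε ^ 3) * y + 3 * ε * y ^ 3) -
      3 / 10 * (ρ * μ) ^ 2 * (y ^ 3 - 4 * y ^ 4 + 6 * y ^ 5 - 4 * y ^ 6 + y ^ 7) -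
      g * ρ / 22 * ((1 + ε) * y + y ^ 2)) ≤
    Real.sin (d * t * (1 + ε - X)) / Real.sin (t / 2) := by
  have hz : 0 ≤ d * t := by positivity
  have hB : |Real.sin (d * t * (1 + ε - X))| ≤ d * t * (1 + ε + y) := by
    refine Real.abs_sin_le_abs.trans ?_
    rw [abs_mul, abs_of_nonneg hz]
    exact mul_le_mul_of_nonneg_left (abs_le.2 ⟨by linarith, by linarith⟩) hz
  have hs := mul_le_sin_mul (z := d * t) (w := 1 + ε - X) (B := y * (y - 1) ^ 4) hz (by positivity)
    fun h => by
      have h1 : 0 ≤ y - 1 := by linarith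
      calc (-(1 + ε - X)) ^ 5 ≤ (y - 1) ^ 5 := pow_le_pow_left₀ (by linarith) (by linarith) 5
        _ = (y - 1) * (y - 1) ^ 4 := by ring
        _ ≤ y * (y - 1) ^ 4 := mul_le_mul_of_nonneg_right (by linarith) (by positivity)
  refine le_trans ?_ (mul_le_div_sin_half ht ht2 hs hB)
  refine mul_le_mul_of_nonneg_left ?_ (by positivity)
  have e4 : (d * t) ^ 4 = 36 * (ρ * μ) ^ 2 * y ^ 2 := by
    rw [show (d * t) ^ 4 = ((d * t) ^ 2) ^ 2 by ring, hdy]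
    ring
  rw [hdy, hty, e4]
  have hQ : y * (1 - X) ^ 3 ≤ y * (1 - y) ^ 3 + ρ / 10 * y ^ 3 * (1 - y) ^ 2 +
      ρ ^ 2 / 300 * y ^ 5 := by
    have h1 : (1 - X) ^ 3 ≤ (1 - y + ρ / 30 * y ^ 2) ^ 3 :=
      (Odd.strictMono_pow (by decide)).monotone (by linarith)
    have h2 : 0 ≤ (ρ / 30 * y ^ 2) ^ 2 * (3 * y - ρ / 30 * y ^ 2) :=
      mul_nonneg (by positivity) (by nlinarith)
    have h3 : (1 - X) ^ 3 ≤ (1 - y) ^ 3 + ρ / 10 * y ^ 2 * (1 - y) ^ 2 + ρ ^ 2 / 300 * y ^ 4 := by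
      linarith
    have := mul_le_mul_of_nonneg_left h3 hy
    linarith
  have hQ2 : (1 - X) ^ 2 ≤ 1 + y ^ 2 := by nlinarith
  have hw : y * (1 + ε - X) ^ 3 ≤ y * (1 - X) ^ 3 + 3 * ε * (y + y ^ 3) +
      (3 * ε ^ 2 + ε ^ 3) * y := by
    have h1 := mul_le_mul_of_nonneg_left hQ2 (show 0 ≤ 3 * ε * y by positivity)
    have h2 := mul_nonneg (show 0 ≤ 3 * ε ^ 2 * y by positivity) hX
    linarith
  have hf := mul_le_mul_of_nonneg_left (hw.trans (add_le_add_left (add_le_add_left hQ _) _))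
    (mul_nonneg hρ hμ)
  linarith

theorem sin_div_sin_le_poly (ht : 0 < t) (ht2 : t ^ 2 ≤ 2) (hd : 0 ≤ d) (hρ : 0 ≤ ρ) (hμ : 0 ≤ μ)
    (hy : 0 ≤ y) (hdy : (d * t) ^ 2 = 6 * (ρ * μ) * y) (hty : t ^ 2 = g * ρ * y)
    (hε : 0 ≤ ε) (hX : 0 ≤ X) (hXy : X ≤ y) (hX1 : y - ρ / 30 * y ^ 2 ≤ X) :
    Real.sin (d * t * (1 - ε - X)) / Real.sin (t / 2) ≤
    2 * d * ((1 - ε) - y + ρ / 30 * y ^ 2 -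
      ρ * μ * ((1 - ε) ^ 3 * y - 3 * (1 - ε) ^ 2 * y ^ 2 + 3 * (1 - ε) * y ^ 3 - y ^ 4) +
      3 / 10 * (ρ * μ) ^ 2 * y ^ 2 + g * ρ / 22 * ((1 + ε) * y + y ^ 2)) := by
  have hz : 0 ≤ d * t := by positivity
  have hB : |-Real.sin (d * t * (1 - ε - X))| ≤ d * t * (1 + ε + y) := by
    rw [abs_neg]
    refine Real.abs_sin_le_abs.trans ?_
    rw [abs_mul, abs_of_nonneg hz]
    exact mul_le_mul_of_nonneg_left (abs_le.2 ⟨by linarith, by linarith⟩) hz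
  have hs := neg_le_neg (sin_mul_le_mul (z := d * t) (w := 1 - ε - X) hz (by linarith))
  rw [← mul_neg] at hs
  have h := mul_le_div_sin_half ht ht2 hs hB
  rw [neg_div, le_neg] at h
  refine h.trans ?_
  rw [← mul_neg]
  refine mul_le_mul_of_nonneg_left ?_ (by positivity)
  have e4 : (d * t) ^ 4 = 36 * (ρ * μ) ^ 2 * y ^ 2 := by
    rw [show (d * t) ^ 4 = ((d * t) ^ 2) ^ 2 by ring, hdy]
    ring
  rw [hdy, hty, e4]
  have hw : (1 - ε - y) ^ 3 ≤ (1 - ε - X) ^ 3 :=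
    (Odd.strictMono_pow (by decide)).monotone (by linarith)
  have hf := mul_le_mul_of_nonneg_left hw (mul_nonneg (mul_nonneg hρ hμ) hy)
  linarith

end

section
variable {k : ℕ} {lam v ρ g d K q : ℝ}

theorem one_le_mul_succ (hk : 1 ≤ k) : (1 : ℝ) ≤ k * (k + 1) := by
  have : (1 : ℝ) ≤ k := by exact_mod_cast hk
  nlinarith

theorem le_mul_mul_cosDefectDeriv (hk : 1 ≤ k) (hlam : 0 < lam) (hK : K = k * (k + 1))
    (hq : q = 2 * k + 1) (hρ : ρ = 6 / (lam * q)) (hv : v = lam * K * q / 6)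
    {t : ℝ} (ht : 0 ≤ t) :
    v * t ^ 2 - ρ / 10 * (v * t ^ 2) ^ 2 ≤ t * (lam * cosDefectDeriv k t) := by
  have hq0 : 0 < q := by rw [hq]; positivity
  have hK0 : 1 ≤ K := hK ▸ one_le_mul_succ hk
  have h := mul_le_mul_of_nonneg_left (le_mul_cosDefectDeriv (k := k) ht) hlam.le
  rw [powSum_two, powSum_four, ← hK, ← hq] at h
  have e : ρ / 10 * (v * t ^ 2) ^ 2 = lam * K ^ 2 * q * t ^ 4 / 60 := by
    rw [hρ, hv]
    field_simp
    ring
  have h0 : 0 ≤ lam * K * q * t ^ 4 := by positivity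
  rw [e, hv]
  linarith

theorem mul_mul_cosDefectDeriv_le (hlam : 0 < lam) (hK : K = k * (k + 1))
    (hq : q = 2 * k + 1) (hv : v = lam * K * q / 6) {t : ℝ} (ht : 0 ≤ t) :
    t * (lam * cosDefectDeriv k t) ≤ v * t ^ 2 := by
  have h := mul_le_mul_of_nonneg_left (mul_cosDefectDeriv_le (k := k) ht) hlam.le
  rw [powSum_two, ← hK, ← hq] at h
  rw [hv]
  linarith

theorem mul_mul_cosDefectDeriv_le_cubic (hk : 1 ≤ k) (hlam : 0 < lam) (hK : K = k * (k + 1))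
    (hq : q = 2 * k + 1) (hρ : ρ = 6 / (lam * q)) (hv : v = lam * K * q / 6) (hg : g = 1 / K)
    {t : ℝ} (ht : 0 ≤ t) :
    t * (lam * cosDefectDeriv k t) ≤ v * t ^ 2 - ρ / 10 * (1 - g / 3) * (v * t ^ 2) ^ 2 +
      ρ ^ 2 / 280 * (v * t ^ 2) ^ 3 := by
  have hq0 : 0 < q := by rw [hq]; positivity
  have hK0 : 1 ≤ K := hK ▸ one_le_mul_succ hk
  have h := mul_le_mul_of_nonneg_left (mul_cosDefectDeriv_le_sextic (k := k) ht) hlam.le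
  rw [powSum_two, powSum_four, powSum_six, ← hK, ← hq] at h
  have e1 : ρ / 10 * (1 - g / 3) * (v * t ^ 2) ^ 2 =
      lam * K ^ 2 * q * t ^ 4 / 60 - lam * K * q * t ^ 4 / 180 := by
    rw [hρ, hv, hg]
    field_simp
    ring
  have e2 : ρ ^ 2 / 280 * (v * t ^ 2) ^ 3 = lam * K ^ 3 * q * t ^ 6 / 1680 := by
    rw [hρ, hv]
    field_simp
    ring
  have h0 : 0 ≤ lam * K * q * t ^ 6 * (3 * K - 1) := mul_nonneg (by positivity) (by linarith)
  rw [e1, e2, hv]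
  linarith

theorem sinDefect_bounds (hk : 1 ≤ k) (hlam : 0 < lam) (hK : K = k * (k + 1))
    (hq : q = 2 * k + 1) (hρ : ρ = 6 / (lam * q)) (hv : v = lam * K * q / 6) (hg : g = 1 / K)
    (hd : d = K / (4 * q)) {t X : ℝ} (ht : 0 < t) (hX : lam * sinDefect k t = d * t * X) :
    0 ≤ X ∧ X ≤ v * t ^ 2 ∧ v * t ^ 2 - ρ / 30 * (v * t ^ 2) ^ 2 ≤ X ∧
      X ≤ v * t ^ 2 - ρ / 30 * (1 - g / 2) * (v * t ^ 2) ^ 2 +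
        ρ ^ 2 / 1680 * (v * t ^ 2) ^ 3 := by
  have hq0 : 0 < q := by rw [hq]; positivity
  have hK0 : 1 ≤ K := hK ▸ one_le_mul_succ hk
  have hdt : 0 < d * t := by rw [hd]; positivity
  have e1 : d * t * (v * t ^ 2) = lam * K ^ 2 * t ^ 3 / 24 := by
    rw [hd, hv]
    field_simp
    ring
  have e2 : d * t * (ρ / 30 * (v * t ^ 2) ^ 2) = lam * K ^ 3 * t ^ 5 / 720 := by
    rw [hd, hv, hρ]
    field_simp
    ring
  have e3 : d * t * (ρ / 30 * (1 - g / 2) * (v * t ^ 2) ^ 2) =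
      lam * K ^ 3 * t ^ 5 / 720 - lam * K ^ 2 * t ^ 5 / 1440 := by
    rw [hd, hv, hρ, hg]
    field_simp
    ring
  have e4 : d * t * (ρ ^ 2 / 1680 * (v * t ^ 2) ^ 3) = lam * K ^ 4 * t ^ 7 / 40320 := by
    rw [hd, hv, hρ]
    field_simp
    ring
  have h1 := mul_nonneg hlam.le (sinDefect_nonneg (k := k) ht.le)
  have h2 := mul_le_mul_of_nonneg_left (sinDefect_le (k := k) ht.le) hlam.le
  have h3 := mul_le_mul_of_nonneg_left (le_sinDefect (k := k) ht.le) hlam.le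
  have h4 := mul_le_mul_of_nonneg_left (sinDefect_le_septic (k := k) ht.le) hlam.le
  rw [powSum_three, ← hK] at h2
  rw [powSum_three, powSum_five, ← hK] at h3
  rw [powSum_three, powSum_five, powSum_seven, ← hK] at h4
  rw [hX] at h1 h2 h3 h4
  have p1 : 0 ≤ lam * K ^ 2 * t ^ 5 := by positivity
  have p2 : 0 ≤ lam * K ^ 2 * t ^ 7 * (4 * K - 2) := mul_nonneg (by positivity) (by linarith)
  refine ⟨le_of_mul_le_mul_left ?_ hdt, le_of_mul_le_mul_left ?_ hdt,
    le_of_mul_le_mul_left ?_ hdt, le_of_mul_le_mul_left ?_ hdt⟩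
  · linarith
  · linarith
  · rw [mul_sub, e1, e2]
    linarith
  · rw [mul_add, mul_sub, e1, e3, e4]
    linarith

theorem scale_sq (hk : 1 ≤ k) (hlam : 0 < lam) (hK : K = k * (k + 1))
    (hq : q = 2 * k + 1) (hρ : ρ = 6 / (lam * q)) (hv : v = lam * K * q / 6) (hg : g = 1 / K)
    (hd : d = K / (4 * q)) (t : ℝ) :
    (d * t) ^ 2 = 6 * (ρ * (1 / (384 + 96 * g))) * (v * t ^ 2) ∧ t ^ 2 = g * ρ * (v * t ^ 2) := by
  have hq0 : 0 < q := by rw [hq]; positivity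
  have hK0 : 1 ≤ K := hK ▸ one_le_mul_succ hk
  have hqK : q ^ 2 = 4 * K + 1 := by rw [hq, hK]; ring
  constructor
  · have e : 6 * (ρ * (1 / (384 + 96 * g))) * (v * t ^ 2) = K ^ 2 * t ^ 2 / (16 * (4 * K + 1)) := by
      rw [hρ, hv, hg]
      field_simp
      ring
    rw [e, ← hqK, hd]
    field_simp
    ring
  · rw [hρ, hv, hg]
    field_simp

end

theorem exp_neg_mul_le {x : ℝ} (hx : 60 ≤ x) : Real.exp (-(0.24 * x)) ≤ 650 / x ^ 5 := by
  have h1 : (x / 60) ^ 5 ≤ Real.exp (0.24 * (x - 60)) := by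
    have h := Real.add_one_le_exp (0.048 * (x - 60))
    calc (x / 60) ^ 5 ≤ Real.exp (0.048 * (x - 60)) ^ 5 :=
          pow_le_pow_left₀ (by positivity) (by linarith) 5
      _ = Real.exp (0.24 * (x - 60)) := by
          rw [← Real.exp_nat_mul]
          congr 1
          push_cast
          ring
  have h2 : (1196400 : ℝ) ≤ Real.exp 14.4 := by
    calc (1196400 : ℝ) ≤ 2.7182818283 ^ 14 := by norm_num
      _ ≤ Real.exp 1 ^ 14 := pow_le_pow_left₀ (by norm_num) Real.exp_one_gt_d9.le 14
      _ = Real.exp 14 := by rw [← Real.exp_nat_mul]; norm_num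
      _ ≤ Real.exp 14.4 := Real.exp_le_exp.2 (by norm_num)
  have h3 : Real.exp (0.24 * x) = Real.exp 14.4 * Real.exp (0.24 * (x - 60)) := by
    rw [← Real.exp_add]
    congr 1
    ring
  have hx0 : 0 < x := by linarith
  rw [Real.exp_neg, le_div_iff₀ (by positivity), inv_mul_le_iff₀ (Real.exp_pos _), h3]
  have h4 := mul_le_mul h2 h1 (by positivity) (Real.exp_pos _).le
  have h5 : 0 ≤ x ^ 5 := by positivity
  linarith

section
variable {k : ℕ} {lam v ρ g d K q T r : ℝ}

theorem le_sin_half (hK2 : 2 ≤ K) (hq0 : 0 < q) (hqK : q ^ 2 = 4 * K + 1) (hT : 0 < T)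
    (hTK : T ^ 2 * K = 4) : 1.94 / q ≤ Real.sin (T / 2) := by
  have h := sub_cube_le_sin (show 0 ≤ T / 2 by positivity)
  refine le_trans ?_ h
  rw [div_le_iff₀ hq0]
  have hT2 : T ^ 2 ≤ 2 := by nlinarith
  refine (sq_le_sq₀ (by norm_num) (mul_nonneg ?_ hq0.le)).1 ?_
  · nlinarith
  · have e : ((T / 2 - (T / 2) ^ 3 / 6) * q) ^ 2 =
        (4 + T ^ 2 / 4) * (1 - T ^ 2 / 24) ^ 2 := by
      rw [mul_pow, hqK]
      linear_combination ((1 - T ^ 2 / 24) ^ 2) * hTK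
    rw [e]
    nlinarith [mul_nonneg (sq_nonneg T) (sub_nonneg.2 hT2), mul_nonneg (mul_nonneg (sq_nonneg T) (sq_nonneg T)) (sub_nonneg.2 hT2)]

theorem le_sin_half_of_le {t : ℝ} (hK2 : 2 ≤ K) (hq0 : 0 < q) (hqK : q ^ 2 = 4 * K + 1)
    (hT : 0 < T) (hTK : T ^ 2 * K = 4) (ht : T ≤ t) (htπ : t ≤ Real.pi) :
    1.94 / q ≤ Real.sin (t / 2) := by
  refine (le_sin_half hK2 hq0 hqK hT hTK).trans ?_
  exact Real.sin_le_sin_of_le_of_le_pi_div_two (by linarith [Real.pi_pos]) (by linarith)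
    (by linarith)

theorem le_cosDefect {t : ℝ} (hK2 : 2 ≤ K) (hq : q = 2 * k + 1) (hqK : q ^ 2 = 4 * K + 1)
    (hT : 0 < T) (hTK : T ^ 2 * K = 4) (ht : T ≤ t) (htπ : t ≤ Real.pi) :
    0.24 * q ≤ cosDefect k t := by
  have hq0 : 0 < q := by rw [hq]; positivity
  have h := le_sin_half_of_le hK2 hq0 hqK hT hTK ht htπ
  have hs : 0 < Real.sin (t / 2) := lt_of_lt_of_le (by positivity) h
  have h1 := two_mul_sin_mul_cosDefect k t
  rw [← hq] at h1
  have h2 := Real.sin_le_one (q * t / 2)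
  rw [div_le_iff₀ hq0] at h
  have h3 : 0 ≤ Real.sin (t / 2) * (cosDefect k t - 0.24 * q) := by linarith
  exact sub_nonneg.1 (nonneg_of_mul_nonneg_right h3 hs)

theorem le_gaussMoment_zero {G : ℝ → ℝ} (hG : Continuous G) (hr : 0 ≤ r) (hrT : r ≤ T)
    (hvr : v * r ^ 2 = 1) (h : ∀ t, G t ≤ v * t ^ 2 / 2) :
    5 / 6 * r ≤ gaussMoment G v T 0 := by
  simp only [gaussMoment, pow_zero, mul_one]
  have hc : ∀ a b, IntervalIntegrable (fun t => Real.exp (-G t)) MeasureTheory.volume a b :=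
    fun a b => Continuous.intervalIntegrable (by fun_prop) _ _
  rw [← intervalIntegral.integral_add_adjacent_intervals (hc 0 r) (hc r T)]
  have h1 : 0 ≤ ∫ t in r..T, Real.exp (-G t) :=
    intervalIntegral.integral_nonneg hrT fun t _ => (Real.exp_pos _).le
  have h2 : ∫ t in (0 : ℝ)..r, (1 - v / 2 * t ^ 2) ≤ ∫ t in (0 : ℝ)..r, Real.exp (-G t) :=
    intervalIntegral.integral_mono_on hr (Continuous.intervalIntegrable (by fun_prop) _ _)
      (hc 0 r) fun t _ => by
        have := Real.add_one_le_exp (-G t)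
        have := h t
        linarith
  have h3 : ∫ t in (0 : ℝ)..r, (1 - v / 2 * t ^ 2) = 5 / 6 * r := by
    rw [intervalIntegral.integral_sub (by simp) (Continuous.intervalIntegrable (by fun_prop) _ _),
      intervalIntegral.integral_const_mul, integral_pow]
    simp
    linear_combination (-r / 6) * hvr
  linarith

theorem le_scale_mul_sq {L : ℝ} (hL : 60 ≤ L) (hKL : 4 * K ≤ L ^ 2) (hv : v = L * K / 6)
    (hr : 0 < r) (hvr : v * r ^ 2 = 1) : 37.9 ≤ r * L ^ 2 := by
  refine (sq_le_sq₀ (by norm_num) (by positivity)).1 ?_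
  have h1 : v * 1440 ≤ L ^ 4 := by
    have : L ^ 3 * 60 ≤ L ^ 3 * L := by gcongr
    have := mul_le_mul_of_nonneg_left hKL (show 0 ≤ L by linarith)
    rw [hv]
    linarith
  have h2 := mul_le_mul_of_nonneg_right h1 (sq_nonneg r)
  nlinarith

theorem le_mul_scale {L : ℝ} (hL : 60 ≤ L) (hv : v = L * K / 6)
    (hr : 0 < r) (hvr : v * r ^ 2 = 1) (hT : 0 < T) (hTK : T ^ 2 * K = 4) :
    T ≤ 0.106 * L * r := by
  refine (sq_le_sq₀ hT.le (by positivity)).1 ?_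
  have hK : 0 < K := by
    by_contra h
    nlinarith [sq_nonneg T]
  have h1 : K * r ^ 2 * L = 6 := by
    rw [hv] at hvr
    linarith
  refine le_of_mul_le_mul_right ?_ hK
  rw [hTK]
  have : (0.106 * L * r) ^ 2 * K = 0.011236 * L * (K * r ^ 2 * L) := by ring
  rw [this, h1]
  linarith

end

/-- The parameters of the Gaussian approximation to the inversion integral. -/
structure SaddleScale (k : ℕ) (lam K q v ρ g d T : ℝ) : Prop where
  one_le_k : 1 ≤ k
  one_le_lam : 1 ≤ lam
  K_eq : K = k * (k + 1)
  q_eq : q = 2 * k + 1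
  le_mul : 60 ≤ lam * q
  ρ_eq : ρ = 6 / (lam * q)
  v_eq : v = lam * K * q / 6
  g_eq : g = 1 / K
  d_eq : d = K / (4 * q)
  T_pos : 0 < T
  T_sq : T ^ 2 * K = 4

theorem intervalIntegrable_exp_mul_sin_div_sin (k : ℕ) {lam : ℝ} (hlam : 0 ≤ lam) (δ : ℝ) :
    IntervalIntegrable (fun t => Real.exp (-(lam * cosDefect k t)) *
      Real.sin (δ * t - lam * sinDefect k t) / Real.sin (t / 2)) MeasureTheory.volume 0 Real.pi := by
  have hA := continuous_cosDefect k
  have hS := continuous_sinDefect k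
  refine (intervalIntegrable_const (c := (|δ| + lam * powSum 3 k * Real.pi ^ 2 / 6) * Real.pi)).mono_fun'
    ?_ ?_
  · refine Measurable.aestronglyMeasurable (Measurable.div ?_ ?_)
    · exact Continuous.measurable (by fun_prop)
    · exact Continuous.measurable (by fun_prop)
  · refine (MeasureTheory.ae_restrict_iff' measurableSet_uIoc).2 (Filter.Eventually.of_forall ?_)
    intro t ht
    rw [Set.uIoc_of_le Real.pi_pos.le] at ht
    obtain ⟨ht0, htπ⟩ := ht
    have hs : t / Real.pi ≤ Real.sin (t / 2) := by
      refine le_trans (le_of_eq ?_) (Real.mul_le_sin (by positivity) (by linarith))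
      field_simp
    have hs0 : 0 < Real.sin (t / 2) := lt_of_lt_of_le (by have := Real.pi_pos; positivity) hs
    have h1 : |δ * t - lam * sinDefect k t| ≤
        (|δ| + lam * powSum 3 k * Real.pi ^ 2 / 6) * t := by
      refine (abs_sub _ _).trans ?_
      have hS0 := sinDefect_nonneg (k := k) ht0.le
      have hS1 := sinDefect_le (k := k) ht0.le
      rw [abs_mul, abs_of_pos ht0, abs_of_nonneg (mul_nonneg hlam hS0)]
      have hp : 0 ≤ powSum 3 k := Finset.sum_nonneg fun i _ => by positivity
      have h2 : lam * sinDefect k t ≤ lam * (powSum 3 k * (t * Real.pi ^ 2) / 6) := by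
        refine mul_le_mul_of_nonneg_left (hS1.trans ?_) hlam
        have : t ^ 3 ≤ t * Real.pi ^ 2 := by
          rw [pow_succ' t 2]
          gcongr
        gcongr
      linarith
    have h3 : Real.exp (-(lam * cosDefect k t)) ≤ 1 :=
      Real.exp_le_one_iff.2 (neg_nonpos.2 (mul_nonneg hlam (cosDefect_nonneg k t)))
    beta_reduce
    rw [Real.norm_eq_abs, abs_div, abs_mul, abs_of_pos hs0, abs_of_pos (Real.exp_pos _),
      div_le_iff₀ hs0]
    have hp : 0 ≤ powSum 3 k := Finset.sum_nonneg fun i _ => by positivity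
    calc _ ≤ 1 * |Real.sin (δ * t - lam * sinDefect k t)| := by gcongr
      _ ≤ (|δ| + lam * powSum 3 k * Real.pi ^ 2 / 6) * t := by
          rw [one_mul]
          exact Real.abs_sin_le_abs.trans h1
      _ = (|δ| + lam * powSum 3 k * Real.pi ^ 2 / 6) * Real.pi * (t / Real.pi) := by
          field_simp
      _ ≤ _ := by
          have := Real.pi_pos
          gcongr

namespace SaddleScale

variable {k : ℕ} {lam K q v ρ g d T : ℝ}

theorem lam_pos (h : SaddleScale k lam K q v ρ g d T) : 0 < lam :=
  zero_lt_one.trans_le h.one_le_lam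

theorem q_pos (h : SaddleScale k lam K q v ρ g d T) : 0 < q := by
  rw [h.q_eq]
  positivity

theorem two_le_K (h : SaddleScale k lam K q v ρ g d T) : 2 ≤ K := by
  have : (1 : ℝ) ≤ k := by exact_mod_cast h.one_le_k
  rw [h.K_eq]
  nlinarith

theorem q_sq (h : SaddleScale k lam K q v ρ g d T) : q ^ 2 = 4 * K + 1 := by
  rw [h.q_eq, h.K_eq]
  ring

theorem v_pos (h : SaddleScale k lam K q v ρ g d T) : 0 < v := by
  have := h.lam_pos
  have := h.q_pos
  have := h.two_le_K
  rw [h.v_eq]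
  positivity

theorem d_pos (h : SaddleScale k lam K q v ρ g d T) : 0 < d := by
  have := h.q_pos
  have := h.two_le_K
  rw [h.d_eq]
  positivity

theorem ρ_pos (h : SaddleScale k lam K q v ρ g d T) : 0 < ρ := by
  have := h.le_mul
  rw [h.ρ_eq]
  exact div_pos (by norm_num) (by linarith)

theorem ρ_le (h : SaddleScale k lam K q v ρ g d T) : ρ ≤ 1 / 10 := by
  have := h.le_mul
  rw [h.ρ_eq, div_le_div_iff₀ (by linarith) (by norm_num)]
  linarith

theorem g_nonneg (h : SaddleScale k lam K q v ρ g d T) : 0 ≤ g := by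
  have := h.two_le_K
  rw [h.g_eq]
  positivity

theorem g_le (h : SaddleScale k lam K q v ρ g d T) : g ≤ 1 / 2 := by
  rw [h.g_eq]
  exact one_div_le_one_div_of_le (by norm_num) h.two_le_K

theorem T_sq_le (h : SaddleScale k lam K q v ρ g d T) : T ^ 2 ≤ 2 := by
  nlinarith [h.two_le_K, h.T_sq, sq_nonneg T]

theorem T_le_pi (h : SaddleScale k lam K q v ρ g d T) : T ≤ Real.pi := by
  nlinarith [h.T_sq_le, Real.pi_gt_three, h.T_pos]

theorem ρ_mul_v (h : SaddleScale k lam K q v ρ g d T) : ρ * v = K := by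
  have := h.lam_pos
  have := h.q_pos
  rw [h.ρ_eq, h.v_eq]
  field_simp

theorem ρ_mul_v_mul_sq (h : SaddleScale k lam K q v ρ g d T) : ρ * (v * T ^ 2) = 4 := by
  rw [← mul_assoc, h.ρ_mul_v, mul_comm, h.T_sq]

theorem exists_width (h : SaddleScale k lam K q v ρ g d T) :
    ∃ r, 0 < r ∧ v * r ^ 2 = 1 ∧ r ≤ T ∧
      5 / 6 * r ≤ gaussMoment (fun t => lam * cosDefect k t) v T 0 := by
  have hv := h.v_pos
  have hr : v * (1 / √v) ^ 2 = 1 := by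
    rw [div_pow, Real.sq_sqrt hv.le]
    field_simp
  have hr0 : 0 < 1 / √v := by positivity
  have hrT : 1 / √v ≤ T := by
    refine (sq_le_sq₀ hr0.le h.T_pos.le).1 (le_of_mul_le_mul_left ?_ hv)
    rw [hr]
    nlinarith [h.ρ_mul_v_mul_sq, h.ρ_le, h.ρ_pos, mul_pos hv (pow_pos h.T_pos 2)]
  refine ⟨1 / √v, hr0, hr, hrT, le_gaussMoment_zero ((continuous_cosDefect k).const_mul lam) hr0.le
    hrT hr fun t => ?_⟩
  have := mul_le_mul_of_nonneg_left (cosDefect_le k t) h.lam_pos.le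
  rw [powSum_two, ← h.K_eq, ← h.q_eq] at this
  rw [h.v_eq]
  linarith

theorem exp_neg_le (h : SaddleScale k lam K q v ρ g d T) {t : ℝ} (ht : T ≤ t)
    (htπ : t ≤ Real.pi) :
    Real.exp (-(lam * cosDefect k t)) ≤ 650 / (lam * q) ^ 5 := by
  refine le_trans (Real.exp_le_exp.2 ?_) (exp_neg_mul_le h.le_mul)
  have := mul_le_mul_of_nonneg_left
    (le_cosDefect h.two_le_K h.q_eq h.q_sq h.T_pos h.T_sq ht htπ) h.lam_pos.le
  linarith

theorem boundary_le (h : SaddleScale k lam K q v ρ g d T) :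
    T * Real.exp (-(lam * cosDefect k T)) ≤
      0.08 * ρ ^ 4 * gaussMoment (fun t => lam * cosDefect k t) v T 0 := by
  obtain ⟨r, hr, hvr, -, hE⟩ := h.exists_width
  have hL := h.le_mul
  have hv : v = lam * q * K / 6 := by rw [h.v_eq]; ring
  have h1 := le_mul_scale hL hv hr hvr h.T_pos h.T_sq
  have h2 := h.exp_neg_le le_rfl h.T_le_pi
  have hL0 : 0 < lam * q := by linarith
  calc _ ≤ 0.106 * (lam * q) * r * (650 / (lam * q) ^ 5) :=
        mul_le_mul h1 h2 (Real.exp_pos _).le (by positivity)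
    _ = 0.08 * ρ ^ 4 * (0.106 * 650 / 0.08 / 1296 * r) := by
        rw [h.ρ_eq]
        field_simp
        norm_num
    _ ≤ _ := mul_le_mul_of_nonneg_left (by linarith) (by positivity)

theorem abs_tail_lt (h : SaddleScale k lam K q v ρ g d T) (δ : ℝ) :
    |∫ t in T..Real.pi, Real.exp (-(lam * cosDefect k t)) *
      Real.sin (δ * t - lam * sinDefect k t) / Real.sin (t / 2)| <
      2 * d * (0.02 * ρ * gaussMoment (fun t => lam * cosDefect k t) v T 0) := by
  obtain ⟨r, hr, hvr, -, hE⟩ := h.exists_width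
  have hL := h.le_mul
  have hq := h.q_pos
  have hK := h.two_le_K
  have hL0 : 0 < lam * q := by linarith
  have hv : v = lam * q * K / 6 := by rw [h.v_eq]; ring
  have hb := intervalIntegral.norm_integral_le_of_norm_le_const (a := T) (b := Real.pi)
    (f := fun t => Real.exp (-(lam * cosDefect k t)) *
      Real.sin (δ * t - lam * sinDefect k t) / Real.sin (t / 2))
    (C := 650 / (lam * q) ^ 5 / (1.94 / q)) fun t ht => by
      rw [Set.uIoc_of_le h.T_le_pi] at ht
      have hs := le_sin_half_of_le hK hq h.q_sq h.T_pos h.T_sq ht.1.le ht.2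
      have hs0 : 0 < Real.sin (t / 2) := lt_of_lt_of_le (by positivity) hs
      rw [Real.norm_eq_abs, abs_div, abs_mul, abs_of_pos hs0, abs_of_pos (Real.exp_pos _)]
      refine div_le_div₀ (by positivity) ?_ (by positivity) hs
      refine (mul_le_of_le_one_right (Real.exp_pos _).le (Real.abs_sin_le_one _)).trans ?_
      exact h.exp_neg_le ht.1.le ht.2
  rw [Real.norm_eq_abs, abs_of_nonneg (sub_nonneg.2 h.T_le_pi)] at hb
  refine hb.trans_lt ?_
  have h1 : 37.9 ≤ r * (lam * q) ^ 2 := by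
    refine le_scale_mul_sq hL ?_ hv hr hvr
    have : q ≤ lam * q := le_mul_of_one_le_left hq.le h.one_le_lam
    have := pow_le_pow_left₀ hq.le this 2
    linarith [h.q_sq]
  have h2 : Real.pi - T ≤ 3.1416 := by linarith [Real.pi_lt_d4, h.T_pos]
  have h3 : 2 * d * (0.02 * ρ * (5 / 6 * r)) ≤
      2 * d * (0.02 * ρ * gaussMoment (fun t => lam * cosDefect k t) v T 0) := by
    have := h.d_pos
    have := h.ρ_pos
    gcongr
  refine lt_of_lt_of_le (lt_of_le_of_lt (mul_le_mul_of_nonneg_left h2 (by positivity)) ?_) h3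
  have e1 : 650 / (lam * q) ^ 5 / (1.94 / q) * 3.1416 =
      650 * 3.1416 / 1.94 * q ^ 2 / (q * (lam * q) ^ 5) := by
    field_simp
  have e2 : 2 * d * (0.02 * ρ * (5 / 6 * r)) =
      0.05 * K * (r * (lam * q) ^ 2 * (lam * q) ^ 2) / (q * (lam * q) ^ 5) := by
    rw [h.d_eq, h.ρ_eq]
    field_simp
    ring
  rw [e1, e2]
  refine div_lt_div_of_pos_right ?_ (by positivity)
  have h4 : 37.9 * 3600 ≤ r * (lam * q) ^ 2 * (lam * q) ^ 2 :=
    mul_le_mul h1 (by nlinarith) (by norm_num) (by positivity)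
  have h5 := mul_le_mul_of_nonneg_left h4 (show 0 ≤ 0.05 * K by positivity)
  rw [h.q_sq]
  linarith

end SaddleScale

namespace SaddleScale

variable {k : ℕ} {lam K q v ρ g d T ε : ℝ}

theorem integral_add_tail (h : SaddleScale k lam K q v ρ g d T) (δ : ℝ) :
    (∫ t in (0 : ℝ)..T, Real.exp (-(lam * cosDefect k t)) *
      Real.sin (δ * t - lam * sinDefect k t) / Real.sin (t / 2)) +
    (∫ t in T..Real.pi, Real.exp (-(lam * cosDefect k t)) *
      Real.sin (δ * t - lam * sinDefect k t) / Real.sin (t / 2)) =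
    ∫ t in (0 : ℝ)..Real.pi, Real.exp (-(lam * cosDefect k t)) *
      Real.sin (δ * t - lam * sinDefect k t) / Real.sin (t / 2) := by
  have hi := intervalIntegrable_exp_mul_sin_div_sin k h.lam_pos.le δ
  have hm : T ∈ Set.uIcc 0 Real.pi := Set.mem_uIcc_of_le h.T_pos.le h.T_le_pi
  exact intervalIntegral.integral_add_adjacent_intervals
    (hi.mono_set (Set.uIcc_subset_uIcc_left hm)) (hi.mono_set (Set.uIcc_subset_uIcc_right hm))

theorem intervalIntegrable_left (h : SaddleScale k lam K q v ρ g d T) (δ : ℝ) :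
    IntervalIntegrable (fun t => Real.exp (-(lam * cosDefect k t)) *
      Real.sin (δ * t - lam * sinDefect k t) / Real.sin (t / 2)) MeasureTheory.volume 0 T :=
  (intervalIntegrable_exp_mul_sin_div_sin k h.lam_pos.le δ).mono_set
    (Set.uIcc_subset_uIcc_left (Set.mem_uIcc_of_le h.T_pos.le h.T_le_pi))

theorem sum_gaussMoment_le (h : SaddleScale k lam K q v ρ g d T) (δ : ℝ) {N : ℕ} (a : Fin N → ℝ)
    (ha : ∀ t, 0 < t → t < T → 2 * d * ∑ i, a i * (v * t ^ 2) ^ (i : ℕ) ≤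
      Real.sin (δ * t - lam * sinDefect k t) / Real.sin (t / 2)) :
    2 * d * ∑ i, a i * gaussMoment (fun t => lam * cosDefect k t) v T i ≤
      ∫ t in (0 : ℝ)..T, Real.exp (-(lam * cosDefect k t)) *
        Real.sin (δ * t - lam * sinDefect k t) / Real.sin (t / 2) := by
  have hc : Continuous fun t => lam * cosDefect k t := (continuous_cosDefect k).const_mul lam
  rw [← integral_exp_neg_mul_sum hc a, ← intervalIntegral.integral_const_mul]
  refine intervalIntegral.integral_mono_on_of_le_Ioo h.T_pos.le
    (Continuous.intervalIntegrable (by fun_prop) _ _) (h.intervalIntegrable_left δ) fun t ht => ?_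
  rw [mul_div_assoc, mul_left_comm]
  exact mul_le_mul_of_nonneg_left (ha t ht.1 ht.2) (Real.exp_pos _).le

theorem le_sum_gaussMoment (h : SaddleScale k lam K q v ρ g d T) (δ : ℝ) {N : ℕ} (a : Fin N → ℝ)
    (ha : ∀ t, 0 < t → t < T → Real.sin (δ * t - lam * sinDefect k t) / Real.sin (t / 2) ≤
      2 * d * ∑ i, a i * (v * t ^ 2) ^ (i : ℕ)) :
    (∫ t in (0 : ℝ)..T, Real.exp (-(lam * cosDefect k t)) *
      Real.sin (δ * t - lam * sinDefect k t) / Real.sin (t / 2)) ≤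
      2 * d * ∑ i, a i * gaussMoment (fun t => lam * cosDefect k t) v T i := by
  have hc : Continuous fun t => lam * cosDefect k t := (continuous_cosDefect k).const_mul lam
  rw [← integral_exp_neg_mul_sum hc a, ← intervalIntegral.integral_const_mul]
  refine intervalIntegral.integral_mono_on_of_le_Ioo h.T_pos.le
    (h.intervalIntegrable_left δ) (Continuous.intervalIntegrable (by fun_prop) _ _) fun t ht => ?_
  rw [mul_div_assoc, mul_left_comm]
  exact mul_le_mul_of_nonneg_left (ha t ht.1 ht.2) (Real.exp_pos _).le

theorem hasDerivAt (_ : SaddleScale k lam K q v ρ g d T) (t : ℝ) :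
    HasDerivAt (fun t => lam * cosDefect k t) (lam * cosDefectDeriv k t) t :=
  (hasDerivAt_cosDefect k t).const_mul lam

theorem continuous_deriv (_ : SaddleScale k lam K q v ρ g d T) :
    Continuous fun t => lam * cosDefectDeriv k t :=
  (continuous_cosDefectDeriv k).const_mul lam

theorem le_mul_deriv (h : SaddleScale k lam K q v ρ g d T) :
    ∀ t ∈ Set.Icc 0 T, v * t ^ 2 - ρ / 10 * (v * t ^ 2) ^ 2 ≤ t * (lam * cosDefectDeriv k t) :=
  fun _ ht => le_mul_mul_cosDefectDeriv h.one_le_k h.lam_pos h.K_eq h.q_eq h.ρ_eq h.v_eq ht.1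

theorem mul_deriv_le (h : SaddleScale k lam K q v ρ g d T) :
    ∀ t ∈ Set.Icc 0 T, t * (lam * cosDefectDeriv k t) ≤ v * t ^ 2 :=
  fun _ ht => mul_mul_cosDefectDeriv_le h.lam_pos h.K_eq h.q_eq h.v_eq ht.1

theorem boundary_mul_pow_le (h : SaddleScale k lam K q v ρ g d T) {j m : ℕ} (hjm : j + m = 4) :
    T * (v * T ^ 2) ^ j * Real.exp (-(lam * cosDefect k T)) ≤
      0.08 * 4 ^ j * ρ ^ m * gaussMoment (fun t => lam * cosDefect k t) v T 0 := by
  refine le_of_mul_le_mul_left ?_ (pow_pos h.ρ_pos j)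
  have h1 := mul_le_mul_of_nonneg_left h.boundary_le (show (0 : ℝ) ≤ 4 ^ j by positivity)
  calc _ = (ρ * (v * T ^ 2)) ^ j * (T * Real.exp (-(lam * cosDefect k T))) := by
        ring
    _ ≤ 4 ^ j * (0.08 * ρ ^ 4 * gaussMoment (fun t => lam * cosDefect k t) v T 0) := by
        rw [h.ρ_mul_v_mul_sq]
        exact h1
    _ = _ := by
        rw [← hjm, pow_add]
        ring

theorem integral_pos (h : SaddleScale k lam K q v ρ g d T) (hε : ρ * (1 / 6 + g) ≤ ε)
    (hε6 : ε ≤ 6) :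
    0 < ∫ t in (0 : ℝ)..Real.pi, Real.exp (-(lam * cosDefect k t)) *
      Real.sin (d * (1 + ε) * t - lam * sinDefect k t) / Real.sin (t / 2) := by
  have hρ := h.ρ_pos
  have hρ1 := h.ρ_le
  have hg := h.g_nonneg
  have hv := h.v_pos
  have hε0 : 0 ≤ ε := le_trans (by positivity) hε
  obtain ⟨μ, hμ⟩ : ∃ μ, μ = 1 / (384 + 96 * g) := ⟨_, rfl⟩
  have hμ0 : 0 ≤ μ := by rw [hμ]; positivity
  have hμ1 : μ * (384 + 96 * g) = 1 := by rw [hμ]; field_simp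
  have hmain := h.sum_gaussMoment_le (d * (1 + ε)) ![1 + ε,
    -1 - ρ * μ * (1 + (3 * ε + 3 * ε ^ 2 + ε ^ 3)) - g * ρ / 22 * (1 + ε),
    ρ / 30 * (1 - g / 2) + 3 * (ρ * μ) - g * ρ / 22,
    -(ρ ^ 2 / 1680) - ρ * μ * (3 + ρ / 10 + 3 * ε) - 3 / 10 * (ρ * μ) ^ 2,
    ρ * μ * (1 + ρ / 5) + 12 / 10 * (ρ * μ) ^ 2,
    -(ρ * μ * (ρ / 10 + ρ ^ 2 / 300)) - 18 / 10 * (ρ * μ) ^ 2,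
    12 / 10 * (ρ * μ) ^ 2, -(3 / 10 * (ρ * μ) ^ 2)] fun t ht0 htT => by
      obtain ⟨hs1, hs2⟩ := scale_sq h.one_le_k h.lam_pos h.K_eq h.q_eq h.ρ_eq h.v_eq h.g_eq h.d_eq t
      have hdt : d * t ≠ 0 := (mul_pos h.d_pos ht0).ne'
      have hX : lam * sinDefect k t = d * t * (lam * sinDefect k t / (d * t)) := by
        rw [mul_div_cancel₀ _ hdt]
      obtain ⟨x0, x1, x2, x3⟩ := sinDefect_bounds h.one_le_k h.lam_pos h.K_eq h.q_eq h.ρ_eq h.v_eq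
        h.g_eq h.d_eq ht0 hX
      have htT2 : t ^ 2 ≤ T ^ 2 := pow_le_pow_left₀ ht0.le htT.le 2
      have hy : ρ * (v * t ^ 2) ≤ 4 := by
        rw [← h.ρ_mul_v_mul_sq]
        gcongr
      have hp := poly_le_sin_div_sin ht0 (htT2.trans h.T_sq_le) h.d_pos.le hρ.le hμ0
        (by positivity) (hμ ▸ hs1) hs2 hy hε0 x0 x1 x2 x3
      rw [show d * (1 + ε) * t - lam * sinDefect k t =
        d * t * (1 + ε - lam * sinDefect k t / (d * t)) by rw [mul_sub (d * t), ← hX]; ring]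
      refine le_trans (le_of_eq ?_) hp
      congr 1
      simp [Fin.sum_univ_succ, Fin.succ]
      ring
  have b0 := h.boundary_mul_pow_le (j := 0) (m := 4) rfl
  have b1 := h.boundary_mul_pow_le (j := 1) (m := 3) rfl
  have b2 := h.boundary_mul_pow_le (j := 2) (m := 2) rfl
  have b3 := h.boundary_mul_pow_le (j := 3) (m := 1) rfl
  have htail := h.abs_tail_lt (d * (1 + ε))
  rw [← h.integral_add_tail]
  have hD := h.hasDerivAt
  have hC := h.continuous_deriv
  have hT := h.T_pos.le
  have hnn := gaussMoment_nonneg (G := fun t => lam * cosDefect k t) hT hv.le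
  have hU := gaussMoment_succ_le hD hC hT hv.le h.le_mul_deriv
  have hL := le_gaussMoment_succ hD hC hT hv.le h.mul_deriv_le
  obtain ⟨c1, c2, c3, -, c5, c6, c7⟩ := gaussMoment_le hD hC hT hv.le hρ.le hρ1
    h.ρ_mul_v_mul_sq.le h.le_mul_deriv
  generalize gaussMoment (fun t => lam * cosDefect k t) v T = E at *
  have u0 := hU 0
  have u1 := hU 1
  have l0 := hL 0
  have l1 := hL 1
  have l2 := hL 2
  have l3 := hL 3
  norm_num at u0 u1 l0 l1 l2 l3 b0 b1 b2 b3
  have hl : E 1 - 3 * E 2 + 3 * E 3 - E 4 ≤ -68 * E 0 + 6 * ρ * E 0 := by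
    have hρE : 0 ≤ ρ * E 0 := mul_nonneg hρ.le (hnn 0)
    have p2 : ρ ^ 2 * E 0 ≤ 1 / 10 * (ρ * E 0) := by
      nlinarith only [mul_le_mul_of_nonneg_right hρ1 hρE]
    have p3 : ρ ^ 3 * E 0 ≤ 1 / 10 * (ρ ^ 2 * E 0) := by
      nlinarith only [mul_le_mul_of_nonneg_right hρ1 (mul_nonneg (sq_nonneg ρ) (hnn 0))]
    have p4 : ρ ^ 4 * E 0 ≤ 1 / 10 * (ρ ^ 3 * E 0) := by
      nlinarith only [mul_le_mul_of_nonneg_right hρ1 (mul_nonneg (pow_nonneg hρ.le 3) (hnn 0))]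
    linarith only [hρE, p2, p3, p4, l0, l1, l2, l3, b0, b1, b2, b3]
  have hcomb := moment_combination_pos hρ.le hρ1 hg h.g_le hμ0 hμ1 hε hε6 (hnn 0) (hnn 4)
    (by linarith) (by linarith) c1 c2 c3 c5 c6 c7 hl
  have hcomb' := mul_le_mul_of_nonneg_left hcomb (show 0 ≤ 2 * d by linarith [h.d_pos])
  have hlt := (abs_lt.1 htail).1
  refine lt_of_lt_of_le ?_ (add_le_add_left (hcomb'.trans (le_trans (le_of_eq ?_) hmain)) _)
  · linarith
  · congr 1
    simp [Fin.sum_univ_succ, Fin.succ]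
    ring

theorem integral_neg (h : SaddleScale k lam K q v ρ g d T) (hε : ρ * (1 / 8 + g) ≤ ε)
    (hε6 : ε ≤ 6) :
    (∫ t in (0 : ℝ)..Real.pi, Real.exp (-(lam * cosDefect k t)) *
      Real.sin (d * (1 - ε) * t - lam * sinDefect k t) / Real.sin (t / 2)) < 0 := by
  have hρ := h.ρ_pos
  have hρ1 := h.ρ_le
  have hg := h.g_nonneg
  have hv := h.v_pos
  have hε0 : 0 ≤ ε := le_trans (by positivity) hε
  obtain ⟨μ, hμ⟩ : ∃ μ, μ = 1 / (384 + 96 * g) := ⟨_, rfl⟩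
  have hμ0 : 0 ≤ μ := by rw [hμ]; positivity
  have hμ1 : μ * (384 + 96 * g) = 1 := by rw [hμ]; field_simp
  have hmain := h.le_sum_gaussMoment (d * (1 - ε)) ![1 - ε,
    -1 - ρ * μ * (1 - ε) ^ 3 + g * ρ / 22 * (1 + ε),
    ρ / 30 + 3 * (ρ * μ) * (1 - ε) ^ 2 + 3 / 10 * (ρ * μ) ^ 2 + g * ρ / 22,
    -(3 * (ρ * μ) * (1 - ε)), ρ * μ] fun t ht0 htT => by
      obtain ⟨hs1, hs2⟩ := scale_sq h.one_le_k h.lam_pos h.K_eq h.q_eq h.ρ_eq h.v_eq h.g_eq h.d_eq t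
      have hdt : d * t ≠ 0 := (mul_pos h.d_pos ht0).ne'
      have hX : lam * sinDefect k t = d * t * (lam * sinDefect k t / (d * t)) := by
        rw [mul_div_cancel₀ _ hdt]
      obtain ⟨x0, x1, x2, -⟩ := sinDefect_bounds h.one_le_k h.lam_pos h.K_eq h.q_eq h.ρ_eq h.v_eq
        h.g_eq h.d_eq ht0 hX
      have htT2 : t ^ 2 ≤ T ^ 2 := pow_le_pow_left₀ ht0.le htT.le 2
      have hp := sin_div_sin_le_poly ht0 (htT2.trans h.T_sq_le) h.d_pos.le hρ.le hμ0
        (by positivity) (hμ ▸ hs1) hs2 hε0 x0 x1 x2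
      rw [show d * (1 - ε) * t - lam * sinDefect k t =
        d * t * (1 - ε - lam * sinDefect k t / (d * t)) by rw [mul_sub (d * t), ← hX]; ring]
      refine hp.trans (le_of_eq ?_)
      congr 1
      simp [Fin.sum_univ_succ, Fin.succ]
      ring
  have b0 := h.boundary_mul_pow_le (j := 0) (m := 4) rfl
  have b1 := h.boundary_mul_pow_le (j := 1) (m := 3) rfl
  have htail := h.abs_tail_lt (d * (1 - ε))
  rw [← h.integral_add_tail]
  have hD := h.hasDerivAt
  have hC := h.continuous_deriv
  have hT := h.T_pos.le
  have hnn := gaussMoment_nonneg (G := fun t => lam * cosDefect k t) hT hv.le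
  have hU := gaussMoment_succ_le hD hC hT hv.le h.le_mul_deriv
  have hL := le_gaussMoment_succ hD hC hT hv.le h.mul_deriv_le
  have hL0 := le_gaussMoment_one hD hC hT fun t ht =>
    mul_mul_cosDefectDeriv_le_cubic h.one_le_k h.lam_pos h.K_eq h.q_eq h.ρ_eq h.v_eq h.g_eq ht.1
  obtain ⟨c1, c2, c3, c4, c5, -, -⟩ := gaussMoment_le hD hC hT hv.le hρ.le hρ1
    h.ρ_mul_v_mul_sq.le h.le_mul_deriv
  generalize gaussMoment (fun t => lam * cosDefect k t) v T = E at *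
  have u0 := hU 0
  have u1 := hU 1
  have u2 := hU 2
  have u3 := hU 3
  have l0 := hL 0
  have l1 := hL 1
  norm_num at u0 u1 u2 u3 l0 l1 b0 b1
  have p3 : ρ ^ 3 ≤ 1 / 100 * ρ := by
    nlinarith only [mul_le_mul hρ1 hρ1 hρ.le (by norm_num), hρ]
  have p3' : ρ ^ 3 ≤ 1 / 1000 := by linarith
  have p4 : ρ ^ 4 ≤ 1 / 1000 * ρ := by
    nlinarith only [mul_le_mul_of_nonneg_right p3' hρ.le]
  have q3 := mul_le_mul_of_nonneg_right p3' (hnn 0)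
  have q4 := mul_le_mul_of_nonneg_right p4 (hnn 0)
  have hρE := mul_nonneg hρ.le (hnn 0)
  have qρ := mul_le_mul_of_nonneg_right hρ1 (hnn 0)
  have hcomb := moment_combination_neg hρ.le hρ1 hg h.g_le hμ0 hμ1 hε hε6 (hnn 0) (hnn 1)
    (hnn 2) (by linarith) (by linarith) (by linarith) (by linarith) hL0
    (b1 := 3 * (T * Real.exp (-(lam * cosDefect k T))) +
      T * (v * T ^ 2) * Real.exp (-(lam * cosDefect k T)))
    (by linarith) (by linarith) (by linarith) c1 c2 c3 c4 c5
  have hcomb' := mul_le_mul_of_nonneg_left hcomb (show 0 ≤ 2 * d by linarith [h.d_pos])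
  have hlt := (abs_lt.1 htail).2
  refine lt_of_le_of_lt (add_le_add_left (hmain.trans (le_trans (le_of_eq ?_) hcomb')) _) ?_
  · congr 1
    simp [Fin.sum_univ_succ, Fin.succ]
    ring
  · linarith

end SaddleScale

theorem rho_mul_le_inv_two_mul {k : ℕ} {q ρ : ℝ} (hk : 1 ≤ k) (hq : q = 2 * k + 1)
    (hρ1 : ρ ≤ 1 / 10) (hρq : ρ * q ≤ 6) :
    ρ * (1 / 6 + 1 / ((k : ℝ) * (k + 1))) ≤ 1 / (2 * k) := by
  have hx : (1 : ℝ) ≤ k := by exact_mod_cast hk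
  have h0 : 0 ≤ 1 / 6 + 1 / ((k : ℝ) * (k + 1)) := by positivity
  have e : (1 / 6 + 1 / ((k : ℝ) * (k + 1))) * (2 * k) = k / 3 + 2 / (k + 1) := by
    field_simp
    ring
  have hpos : 0 ≤ (k : ℝ) / 3 + 2 / (k + 1) := by positivity
  rw [le_div_iff₀ (by positivity), mul_assoc, e]
  rcases Nat.lt_or_ge k 11 with h | h
  · have hx' : (k : ℝ) ≤ 10 := by exact_mod_cast Nat.le_of_lt_succ h
    have h2 : 2 / ((k : ℝ) + 1) ≤ 1 := (div_le_one (by positivity)).2 (by linarith)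
    nlinarith only [mul_le_mul_of_nonneg_right hρ1 hpos, h2, hx']
  · have hx' : (11 : ℝ) ≤ k := by exact_mod_cast h
    have h2 : 2 / ((k : ℝ) + 1) ≤ 1 / 6 :=
      (div_le_div_iff₀ (by positivity) (by norm_num)).2 (by linarith)
    have hq0 : 0 < q := by rw [hq]; positivity
    have h3 : (k : ℝ) / 3 + 2 / (k + 1) ≤ q / 6 := by rw [hq]; linarith
    have hρ6 : ρ ≤ 6 / q := (le_div_iff₀ hq0).2 hρq
    calc _ ≤ 6 / q * (k / 3 + 2 / (k + 1)) := mul_le_mul_of_nonneg_right hρ6 hpos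
      _ ≤ 6 / q * (q / 6) := mul_le_mul_of_nonneg_left h3 (by positivity)
      _ = 1 := by field_simp

theorem rho_mul_le_inv_two_mul_succ {k : ℕ} {q ρ : ℝ} (hk : 1 ≤ k) (hq : q = 2 * k + 1)
    (hρ1 : ρ ≤ 1 / 10) (hρq : ρ * q ≤ 6) :
    ρ * (1 / 8 + 1 / ((k : ℝ) * (k + 1))) ≤ 1 / (2 * (k + 1)) := by
  have hx : (1 : ℝ) ≤ k := by exact_mod_cast hk
  have e : (1 / 8 + 1 / ((k : ℝ) * (k + 1))) * (2 * (k + 1)) = (k + 1) / 4 + 2 / k := by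
    field_simp
    ring
  have hpos : 0 ≤ ((k : ℝ) + 1) / 4 + 2 / k := by positivity
  rw [le_div_iff₀ (by positivity), mul_assoc, e]
  rcases Nat.lt_or_ge k 11 with h | h
  · have hx' : (k : ℝ) ≤ 10 := by exact_mod_cast Nat.le_of_lt_succ h
    have h2 : 2 / (k : ℝ) ≤ 2 := (div_le_iff₀ (by positivity)).2 (by linarith)
    nlinarith only [mul_le_mul_of_nonneg_right hρ1 hpos, h2, hx']
  · have hx' : (11 : ℝ) ≤ k := by exact_mod_cast h
    have h2 : 2 / (k : ℝ) ≤ 2 / 11 :=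
      (div_le_div_iff₀ (by positivity) (by norm_num)).2 (by linarith)
    have hq0 : 0 < q := by rw [hq]; positivity
    have h3 : ((k : ℝ) + 1) / 4 + 2 / k ≤ q / 6 := by rw [hq]; linarith
    have hρ6 : ρ ≤ 6 / q := (le_div_iff₀ hq0).2 hρq
    calc _ ≤ 6 / q * ((k + 1) / 4 + 2 / k) := mul_le_mul_of_nonneg_right hρ6 hpos
      _ ≤ 6 / q * (q / 6) := mul_le_mul_of_nonneg_left h3 (by positivity)
      _ = 1 := by field_simp

/-- The median formula when `n` is large compared with `k`, by Fourier inversion. -/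
theorem poissonOrderKMedian_of_thirty_mul_le {k n : ℕ} (hk : 1 ≤ k) (hn : k * (k + 1) / 2 ≤ n)
    (hL : 30 * (k * (k + 1)) ≤ n * (2 * k + 1)) :
    poissonOrderKMedian k ((n : ℝ) / ((k * (k + 1) / 2 : ℕ) : ℝ)) = n - (k + 4) / 8 := by
  have hx : (1 : ℝ) ≤ k := by exact_mod_cast hk
  have hκ : ((k * (k + 1) / 2 : ℕ) : ℝ) = (k : ℝ) * (k + 1) / 2 := by
    rw [Nat.cast_div (Nat.even_mul_succ_self k).two_dvd (by norm_num)]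
    push_cast
    ring
  have hnκ : (k : ℝ) * (k + 1) / 2 ≤ n := by
    rw [← hκ]
    exact_mod_cast hn
  rw [hκ]
  obtain ⟨lam, hlam⟩ : ∃ lam : ℝ, lam = n / ((k : ℝ) * (k + 1) / 2) := ⟨_, rfl⟩
  rw [← hlam]
  have hκ0 : 0 < (k : ℝ) * (k + 1) / 2 := by positivity
  have hlam1 : 1 ≤ lam := by rwa [hlam, le_div_iff₀ hκ0, one_mul]
  have hlamκ : lam * ((k : ℝ) * (k + 1) / 2) = n := by
    rw [hlam]
    exact div_mul_cancel₀ _ hκ0.ne'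
  have hle : 60 ≤ lam * (2 * k + 1) := by
    have hL' : (30 : ℝ) * (k * (k + 1)) ≤ n * (2 * k + 1) := by exact_mod_cast hL
    rw [hlam, div_mul_eq_mul_div, le_div_iff₀ hκ0]
    linarith
  obtain ⟨M, hM⟩ : ∃ M, M = (k + 4) / 8 := ⟨_, rfl⟩
  rw [← hM]
  have hM1 : 8 * M ≤ k + 4 := by omega
  have hM2 : k ≤ 8 * M + 3 := by omega
  have hM1' : 8 * (M : ℝ) ≤ k + 4 := by exact_mod_cast hM1
  have hM2' : (k : ℝ) ≤ 8 * M + 3 := by exact_mod_cast hM2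
  obtain ⟨m, hm⟩ : ∃ m, n = m + 1 + M := by
    have : 10 * k ≤ n := by
      by_contra! h
      nlinarith
    exact ⟨n - M - 1, by omega⟩
  have hT : 0 < 2 / √((k : ℝ) * (k + 1)) := by positivity
  have S : SaddleScale k lam (k * (k + 1)) (2 * k + 1) (lam * (k * (k + 1)) * (2 * k + 1) / 6)
      (6 / (lam * (2 * k + 1))) (1 / ((k : ℝ) * (k + 1))) ((k * (k + 1)) / (4 * (2 * k + 1)))
      (2 / √((k : ℝ) * (k + 1))) := by
    refine ⟨hk, hlam1, rfl, rfl, hle, rfl, rfl, rfl, rfl, hT, ?_⟩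
    rw [div_pow, Real.sq_sqrt (by positivity)]
    field_simp
    norm_num
  have hρ1 := S.ρ_le
  have hρq : 6 / (lam * (2 * k + 1)) * (2 * k + 1) ≤ 6 := by
    have := S.lam_pos
    rw [div_mul_eq_mul_div, div_le_iff₀ (by positivity)]
    have : (0 : ℝ) ≤ (2 * k + 1) := by positivity
    nlinarith
  have hd := S.d_pos
  have hpos := S.integral_pos
    (ε := ((M : ℝ) + 1 / 2) / (k * (k + 1) / (4 * (2 * k + 1))) - 1)
    ((rho_mul_le_inv_two_mul hk rfl hρ1 hρq).trans (by
      rw [le_sub_iff_add_le, le_div_iff₀ hd]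
      have : (1 / (2 * (k : ℝ)) + 1) * (k * (k + 1) / (4 * (2 * k + 1))) = (k + 1) / 8 := by
        field_simp
        ring
      linarith)) (by
      rw [sub_le_iff_le_add, div_le_iff₀ hd, ← mul_div_assoc, le_div_iff₀ (by positivity)]
      nlinarith)
  have hneg := S.integral_neg
    (ε := 1 - ((M : ℝ) - 1 / 2) / (k * (k + 1) / (4 * (2 * k + 1))))
    ((rho_mul_le_inv_two_mul_succ hk rfl hρ1 hρq).trans (by
      rw [le_sub_comm, div_le_iff₀ hd]
      have : (1 - 1 / (2 * ((k : ℝ) + 1))) * (k * (k + 1) / (4 * (2 * k + 1))) = k / 8 := by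
        field_simp
        ring
      linarith)) (by
      rw [sub_le_comm, le_div_iff₀ hd, ← mul_div_assoc, div_le_iff₀ (by positivity)]
      have : (0 : ℝ) ≤ M := by positivity
      nlinarith)
  have hnm : (n : ℝ) = m + 1 + M := by exact_mod_cast hm
  have e1 : ∀ x : ℝ, (k * (k + 1) / (4 * (2 * (k : ℝ) + 1))) *
      (1 + (x / (k * (k + 1) / (4 * (2 * k + 1))) - 1)) = x := fun x => by
    rw [add_sub_cancel, mul_div_cancel₀ _ hd.ne']
  have e2 : ∀ x : ℝ, (k * (k + 1) / (4 * (2 * (k : ℝ) + 1))) *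
      (1 - (1 - x / (k * (k + 1) / (4 * (2 * k + 1))))) = x := fun x => by
    rw [sub_sub_cancel, mul_div_cancel₀ _ hd.ne']
  rw [e1] at hpos
  rw [e2] at hneg
  have i1 := integral_exp_mul_sin_div_sin k S.lam_pos.le m
  have i2 := integral_exp_mul_sin_div_sin k S.lam_pos.le (m + 1)
  rw [hlamκ, hnm] at i1 i2
  rw [show (m : ℝ) + 1 + M - (m + 1 / 2) = M + 1 / 2 by ring] at i1
  rw [show (m : ℝ) + 1 + M - ((m + 1 : ℕ) + 1 / 2) = M - 1 / 2 by push_cast; ring] at i2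
  rw [i1] at hpos
  rw [i2] at hneg
  have hp := (pos_iff_pos_of_mul_pos hpos).1 Real.pi_pos
  have hq := neg_of_mul_neg_right hneg Real.pi_pos.le
  rw [show n - M = m + 1 by omega]
  exact poissonOrderKMedian_eq S.lam_pos.le (by linarith) (by linarith)

/-- `panjerCheck` for all `n` with `k (k + 1) / 2 ≤ n ≤ 30 k (k + 1) / (2 k + 1)`. The checks below
are split into several theorems to bound the memory used by the kernel. -/
def panjerTable (k : ℕ) : Bool :=
  panjerCheckRange (10 ^ 20) k (k * (k + 1) / 2)
    (30 * (k * (k + 1)) / (2 * k + 1) + 1 - k * (k + 1) / 2)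

theorem panjerTable_zero_add : ∀ i < 11, panjerTable (0 + i) = true := by
  decide +kernel

theorem panjerTable_eleven_add : ∀ i < 3, panjerTable (11 + i) = true := by
  decide +kernel

theorem panjerTable_fourteen_add : ∀ i < 2, panjerTable (14 + i) = true := by
  decide +kernel

theorem panjerTable_sixteen_add : ∀ i < 2, panjerTable (16 + i) = true := by
  decide +kernel

theorem panjerTable_eighteen_add : ∀ i < 2, panjerTable (18 + i) = true := by
  decide +kernel

theorem panjerTable_twenty_add : ∀ i < 2, panjerTable (20 + i) = true := by
  decide +kernel

theorem panjerTable_twenty_two_add : ∀ i < 2, panjerTable (22 + i) = true := by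
  decide +kernel

theorem panjerTable_twenty_four_add : ∀ i < 2, panjerTable (24 + i) = true := by
  decide +kernel

theorem panjerTable_twenty_six_add : ∀ i < 4, panjerTable (26 + i) = true := by
  decide +kernel

theorem panjerTable_of_lt_thirty {k : ℕ} (hk : k < 30) : panjerTable k = true := by
  have of_add : ∀ {a c : ℕ}, (∀ i < c, panjerTable (a + i) = true) → a ≤ k → k < a + c →
      panjerTable k = true := fun {a c} h h1 h2 => by
    have := h (k - a) (by omega)
    rwa [Nat.add_sub_cancel' h1] at this
  rcases lt_or_ge k 11 with h | h
  · exact of_add panjerTable_zero_add (by omega) (by omega)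
  rcases lt_or_ge k 14 with h | h
  · exact of_add panjerTable_eleven_add (by omega) (by omega)
  rcases lt_or_ge k 16 with h | h
  · exact of_add panjerTable_fourteen_add (by omega) (by omega)
  rcases lt_or_ge k 18 with h | h
  · exact of_add panjerTable_sixteen_add (by omega) (by omega)
  rcases lt_or_ge k 20 with h | h
  · exact of_add panjerTable_eighteen_add (by omega) (by omega)
  rcases lt_or_ge k 22 with h | h
  · exact of_add panjerTable_twenty_add (by omega) (by omega)
  rcases lt_or_ge k 24 with h | h
  · exact of_add panjerTable_twenty_two_add (by omega) (by omega)
  rcases lt_or_ge k 26 with h | h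
  · exact of_add panjerTable_twenty_four_add (by omega) (by omega)
  exact of_add panjerTable_twenty_six_add (by omega) (by omega)

/-- The median formula when `n` is small compared with `k`, by evaluation of the Panjer
recurrence. -/
theorem poissonOrderKMedian_of_lt_thirty_mul {k n : ℕ} (hk : 1 ≤ k) (hn : k * (k + 1) / 2 ≤ n)
    (hL : n * (2 * k + 1) < 30 * (k * (k + 1))) :
    poissonOrderKMedian k ((n : ℝ) / ((k * (k + 1) / 2 : ℕ) : ℝ)) = n - (k + 4) / 8 := by
  obtain ⟨κ, hκ⟩ := (Nat.even_mul_succ_self k).two_dvd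
  have hκn : κ ≤ n := by omega
  have hk30 : k < 30 := by
    by_contra! h
    nlinarith
  have hn' : n ≤ 30 * (k * (k + 1)) / (2 * k + 1) :=
    (Nat.le_div_iff_mul_le (by omega)).2 hL.le
  have hs : n < 10 ^ 20 := by
    have : n ≤ n * (2 * k + 1) := Nat.le_mul_of_pos_right n (by omega)
    nlinarith
  exact poissonOrderKMedian_of_panjerCheck hk hn hs
    (panjerCheck_of_range (panjerTable_of_lt_thirty hk30) hn (by omega))

/-- Conjecture: For k ≥ 1 and an integer n ≥ κ = k(k+1)/2, with
λ = n/κ (so the mean equals n), the median of the Poisson distribution of order k is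
ν_k(n/κ) = n − ⌊(k+4)/8⌋. -/
theorem poissonOrderK_median_integer_mean (k n : ℕ) (hk : 1 ≤ k)
    (hn : k * (k + 1) / 2 ≤ n) :
    poissonOrderKMedian k ((n : ℝ) / ((k * (k + 1) / 2 : ℕ) : ℝ)) = n - (k + 4) / 8 := by
  rcases le_or_gt (30 * (k * (k + 1))) (n * (2 * k + 1)) with h | h
  · exact poissonOrderKMedian_of_thirty_mul_le hk hn h
  · exact poissonOrderKMedian_of_lt_thirty_mul hk hn h
end
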